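/- arXiv:math/0512003 — 3 statements merged into one kernel-verified Lean document; each statement's English description precedes it below -/
import Mathlib

section
/- If a set Λ ⊆ ℤ is symmetric with respect to zero (Λ = −Λ) and contains arbitrarily long segments of consecutive integers (for every L ∈ ℕ there exists a ∈ ℤ with {a, a+1, …, a+L} ⊆ Λ), then Λ is a Menshov spectrum. (Arutyunyan's theorem.) -/
open MeasureTheory Filter Topology Real

instance : Fact (0 < 2 * π) := ⟨by positivity⟩

/-- The symmetric partial sum `S_N(t) = ∑_{k ∈ Λ, |k| ≤ N} c_k e^{ikt}` on the circle
`𝕋 = ℝ/2πℤ`. -/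
noncomputable def menshovPartialSum (Λ : Set ℤ) (c : ℤ → ℂ) (N : ℕ)
    (t : AddCircle (2 * π)) : ℂ :=
  ∑ k ∈ Finset.Icc (-(N : ℤ)) (N : ℤ), Λ.indicator c k * fourier k t

/-- A set `Λ ⊆ ℤ` is a Menshov spectrum if every measurable `f : 𝕋 → ℂ` admits a
representation `f(t) = ∑_{k ∈ Λ} c_k e^{ikt}` with symmetric partial sums converging
almost everywhere. -/
def IsMenshovSpectrum (Λ : Set ℤ) : Prop :=
  ∀ f : AddCircle (2 * π) → ℂ, Measurable f → ∃ c : ℤ → ℂ,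
    ∀ᵐ t : AddCircle (2 * π),
      Tendsto (fun N => menshovPartialSum Λ c N t) atTop (𝓝 (f t))


namespace ArMen

/-- The circle. -/
abbrev TT : Type := AddCircle (2 * π)

/-- Normalised Haar measure on the circle. -/
noncomputable abbrev μT : Measure TT := AddCircle.haarAddCircle

/-- Complex indicator function. -/
noncomputable def indC (S : Set TT) : TT → ℂ := S.indicator (fun _ => 1)

lemma fc_ind {A : Set TT} (hA : MeasurableSet A) (k : ℤ) :
    fourierCoeff (indC A) k = ∫ y in A, fourier (-k) y ∂μT := by
  rw [fourierCoeff, ← integral_indicator hA]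
  congr 1
  ext y
  by_cases h : y ∈ A <;> simp [indC, h]

lemma norm_fourier (k : ℤ) (t : TT) : ‖(fourier k t : ℂ)‖ = 1 := Circle.norm_coe _

lemma ind_parseval {A B : Set TT} (hA : MeasurableSet A) (hB : MeasurableSet B) :
    HasSum (fun k : ℤ => (starRingEnd ℂ) (fourierCoeff (indC A) k) * fourierCoeff (indC B) k)
      ((μT.real (A ∩ B) : ℝ) : ℂ) := by
  have key : ∀ {S : Set TT} (hS : MeasurableSet S) (k : ℤ),
      inner ℂ ((fourierBasis : HilbertBasis ℤ ℂ (Lp ℂ 2 μT)) k)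
        (indicatorConstLp 2 hS (measure_ne_top μT S) (1 : ℂ)) = fourierCoeff (indC S) k := by
    intro S hS k
    rw [← HilbertBasis.repr_apply_apply, fourierBasis_repr]
    exact congrFun (fourierCoeff_congr_ae indicatorConstLp_coeFn) k
  have h := (fourierBasis : HilbertBasis ℤ ℂ (Lp ℂ 2 μT)).hasSum_inner_mul_inner
    (indicatorConstLp 2 hA (measure_ne_top μT A) (1 : ℂ))
    (indicatorConstLp 2 hB (measure_ne_top μT B) (1 : ℂ))
  rw [L2.inner_indicatorConstLp_one_indicatorConstLp_one hA hB] at h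
  convert! h using 2 with k
  rw [key hB, ← inner_conj_symm, key hA]

lemma ind_sq {A : Set TT} (hA : MeasurableSet A) :
    HasSum (fun k : ℤ => ‖fourierCoeff (indC A) k‖ ^ 2) (μT.real A) := by
  have h := ind_parseval hA hA
  rw [Set.inter_self] at h
  rw [← Complex.hasSum_ofReal]
  convert! h using 2 with k
  rw [Complex.conj_mul']
  push_cast
  rfl

lemma ind_summable {A B : Set TT} (hA : MeasurableSet A) (hB : MeasurableSet B) :
    Summable (fun k : ℤ => ‖(starRingEnd ℂ) (fourierCoeff (indC A) k) * fourierCoeff (indC B) k‖) ∧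
    ∑' k : ℤ, ‖(starRingEnd ℂ) (fourierCoeff (indC A) k) * fourierCoeff (indC B) k‖
      ≤ (μT.real A + μT.real B) / 2 := by
  have hs := ((ind_sq hA).add (ind_sq hB)).div_const 2
  have hle : ∀ k : ℤ, ‖(starRingEnd ℂ) (fourierCoeff (indC A) k) * fourierCoeff (indC B) k‖ ≤
      (‖fourierCoeff (indC A) k‖ ^ 2 + ‖fourierCoeff (indC B) k‖ ^ 2) / 2 := by
    intro k
    rw [norm_mul, RCLike.norm_conj]
    nlinarith [sq_nonneg (‖fourierCoeff (indC A) k‖ - ‖fourierCoeff (indC B) k‖)]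
  have h1 := Summable.of_nonneg_of_le (fun k => norm_nonneg _) hle hs.summable
  exact ⟨h1, (h1.tsum_le_tsum hle hs.summable).trans hs.tsum_eq.le⟩

lemma fourier_sub' (k : ℤ) (y s : TT) :
    (fourier k (y - s) : ℂ) = fourier k y * fourier (-k) s := by
  simp [fourier_apply, sub_eq_add_neg, AddCircle.toCircle_add, AddCircle.toCircle_neg]

lemma dirichlet_id (u : TT) (p q : ℤ) (h : p ≤ q) :
    (∑ k ∈ Finset.Icc p q, (fourier k u : ℂ)) * (1 - fourier 1 u) =
      fourier p u - fourier (q + 1) u := by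
  induction q, h using Int.leInduction with
  | base =>
    rw [Finset.Icc_self, Finset.sum_singleton, fourier_add]
    ring
  | succ r hr ih =>
    have : Finset.Icc p (r + 1) = insert (r + 1) (Finset.Icc p r) := by
      ext x; simp only [Finset.mem_Icc, Finset.mem_insert]; omega
    rw [this, Finset.sum_insert (by simp), add_mul, ih, fourier_add (m := r + 1)]
    ring

lemma dirichlet_bd (u : TT) {κ : ℝ} (hκ : 0 < κ) (hu : κ ≤ ‖1 - (fourier 1 u : ℂ)‖) (p q : ℤ) :
    ‖∑ k ∈ Finset.Icc p q, (fourier k u : ℂ)‖ ≤ 2 / κ := by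
  by_cases h : p ≤ q
  · rw [le_div_iff₀ hκ]
    calc _ ≤ ‖∑ k ∈ Finset.Icc p q, (fourier k u : ℂ)‖ * ‖1 - (fourier 1 u : ℂ)‖ := by gcongr
      _ = ‖(fourier p u : ℂ) - fourier (q + 1) u‖ := by rw [← norm_mul, dirichlet_id u p q h]
      _ ≤ 2 := by
        refine (norm_sub_le _ _).trans ?_
        rw [norm_fourier, norm_fourier]; norm_num
  · rw [Finset.Icc_eq_empty h]; simp; positivity

lemma kappa_exists {D : ℝ} (hD : 0 < D) :
    ∃ κ > 0, ∀ u : TT, D ≤ ‖u‖ → κ ≤ ‖1 - (fourier 1 u : ℂ)‖ := by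
  have hcl : IsClosed {u : TT | D ≤ ‖u‖} := isClosed_le continuous_const continuous_norm
  rcases Set.eq_empty_or_nonempty {u : TT | D ≤ ‖u‖} with he | hne
  · refine ⟨1, one_pos, fun u hu => ?_⟩
    have : u ∈ {u : TT | D ≤ ‖u‖} := hu
    rw [he] at this
    exact this.elim
  · have hc : Continuous fun u : TT => ‖1 - (fourier 1 u : ℂ)‖ := by fun_prop
    obtain ⟨u0, hu0, hmin⟩ := hcl.isCompact.exists_isMinOn hne hc.continuousOn
    refine ⟨_, ?_, fun u hu => hmin hu⟩
    change 0 < ‖1 - (fourier 1 u0 : ℂ)‖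
    rw [norm_pos_iff, sub_ne_zero]
    intro h
    rw [fourier_one] at h
    have h2 : AddCircle.toCircle u0 = AddCircle.toCircle (0 : TT) := by
      rw [AddCircle.toCircle_zero]; ext; simpa using h.symm
    have h3 := AddCircle.injective_toCircle (by positivity) h2
    rw [h3] at hu0
    simp at hu0
    linarith

lemma window_far {A B : Set TT} (hA : MeasurableSet A) (hB : MeasurableSet B) {κ : ℝ} (hκ : 0 < κ)
    (h : ∀ y ∈ A, ∀ s ∈ B, κ ≤ ‖1 - (fourier 1 (y - s) : ℂ)‖) (p q : ℤ) :
    ‖∑ k ∈ Finset.Icc p q, (starRingEnd ℂ) (fourierCoeff (indC A) k) * fourierCoeff (indC B) k‖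
      ≤ 2 / κ * μT.real B * μT.real A := by
  have hintegr : ∀ (S : Set TT) (F : TT → ℂ), Continuous F → Integrable F (μT.restrict S) :=
    fun S F hF => (hF.integrable_of_hasCompactSupport
      (HasCompactSupport.of_compactSpace F)).restrict
  have h1 : ∀ y : TT, ∑ k ∈ Finset.Icc p q, (fourier k y : ℂ) * fourierCoeff (indC B) k
      = ∫ s in B, ∑ k ∈ Finset.Icc p q, (fourier k (y - s) : ℂ) ∂μT := by
    intro y
    rw [integral_finsetSum _ (fun k _ => hintegr _ _ (by fun_prop))]
    refine Finset.sum_congr rfl fun k _ => ?_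
    rw [fc_ind hB, ← integral_const_mul]
    simp_rw [fourier_sub']
  have h2 : ∑ k ∈ Finset.Icc p q,
      (starRingEnd ℂ) (fourierCoeff (indC A) k) * fourierCoeff (indC B) k
      = ∫ y in A, ∑ k ∈ Finset.Icc p q, (fourier k y : ℂ) * fourierCoeff (indC B) k ∂μT := by
    rw [integral_finsetSum _ (fun k _ => hintegr _ _ (by fun_prop))]
    refine Finset.sum_congr rfl fun k _ => ?_
    rw [integral_mul_const, fc_ind hA, ← integral_conj]
    simp_rw [← fourier_neg, neg_neg]
  rw [h2]
  refine norm_setIntegral_le_of_norm_le_const (measure_lt_top _ _) fun y hy => ?_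
  rw [h1]
  refine norm_setIntegral_le_of_norm_le_const (measure_lt_top _ _) fun s hs => ?_
  exact dirichlet_bd _ hκ (h y hy s hs) p q

end ArMen


namespace ArMen

lemma fc_ball (t : TT) (w : ℝ) (k : ℤ) :
    fourierCoeff (indC (Metric.closedBall t w)) k =
      fourier (-k) t * fourierCoeff (indC (Metric.closedBall 0 w)) k := by
  unfold fourierCoeff
  rw [← integral_add_right_eq_self _ t, ← integral_const_mul]
  congr 1
  ext y
  have h : indC (Metric.closedBall t w) (y + t) = indC (Metric.closedBall 0 w) y := by
    simp [indC, Set.indicator, dist_eq_norm]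
  have h2 : (fourier (-k) (y + t) : ℂ) = fourier (-k) t * fourier (-k) y := by
    simp [fourier_apply, AddCircle.toCircle_add]; ring
  rw [h, h2, smul_eq_mul, smul_eq_mul, mul_assoc]

/-- Arc number `i` of length `w`. -/
noncomputable def arc (w : ℝ) (i : ℕ) : Set TT :=
  {t | ((AddCircle.equivIoc (2 * π) 0 t : Set.Ioc (0 : ℝ) (0 + 2 * π)) : ℝ) ∈
    Set.Ioc ((i : ℝ) * w) (((i : ℝ) + 1) * w)}

lemma arc_meas (w : ℝ) (i : ℕ) : MeasurableSet (arc w i) := by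
  have h : Measurable (fun t : TT =>
      ((AddCircle.equivIoc (2 * π) 0 t : Set.Ioc (0 : ℝ) (0 + 2 * π)) : ℝ)) :=
    measurable_subtype_coe.comp (AddCircle.measurableEquivIoc (2 * π) 0).measurable
  exact h measurableSet_Ioc

lemma arc_pre (w : ℝ) (i : ℕ) :
    (QuotientAddGroup.mk ⁻¹' (arc w i) : Set ℝ) ∩ Set.Ioc 0 (0 + 2 * π) =
      Set.Ioc ((i : ℝ) * w) (((i : ℝ) + 1) * w) ∩ Set.Ioc 0 (0 + 2 * π) := by
  ext s
  simp only [Set.mem_inter_iff, and_congr_left_iff]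
  intro hs
  have : ((AddCircle.equivIoc (2 * π) 0 ((s : ℝ) : TT) : Set.Ioc (0 : ℝ) (0 + 2 * π)) : ℝ) = s :=
    AddCircle.equivIoc_coe_of_mem hs
  change ((AddCircle.equivIoc (2 * π) 0 ((s : ℝ) : TT) : Set.Ioc (0 : ℝ) (0 + 2 * π)) : ℝ) ∈
    Set.Ioc ((i : ℝ) * w) (((i : ℝ) + 1) * w) ↔ _
  rw [this]

lemma arc_rep {w : ℝ} {i : ℕ} {t : TT} (h : t ∈ arc w i) :
    ∃ s : ℝ, (s : TT) = t ∧ s ∈ Set.Ioc ((i : ℝ) * w) (((i : ℝ) + 1) * w) :=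
  ⟨_, AddCircle.coe_equivIoc, h⟩

lemma muT_eq (S : Set TT) : μT.real S = volume.real S / (2 * π) := by
  rw [AddCircle.volume_eq_smul_haarAddCircle, measureReal_ennreal_smul_apply,
    ENNReal.toReal_ofReal (by positivity)]
  field_simp

lemma arc_le {w : ℝ} (hw : 0 < w) (i : ℕ) : μT.real (arc w i) ≤ w / (2 * π) := by
  rw [muT_eq]
  gcongr
  rw [Measure.real, AddCircle.add_projection_respects_measure (2 * π) 0 (arc_meas w i), arc_pre]
  refine ENNReal.toReal_le_of_le_ofReal hw.le ?_
  refine (measure_mono Set.inter_subset_left).trans ?_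
  rw [Real.volume_Ioc]
  apply ENNReal.ofReal_le_ofReal; linarith

lemma arc_eq {w : ℝ} {n i : ℕ} (hw : 0 < w) (hn : n * w = 2 * π) (hi : i < n) :
    μT.real (arc w i) = w / (2 * π) := by
  rw [muT_eq]
  congr 1
  rw [Measure.real, AddCircle.add_projection_respects_measure (2 * π) 0 (arc_meas w i), arc_pre]
  rw [Set.inter_eq_left.2, Real.volume_Ioc, ENNReal.toReal_ofReal] <;> ring_nf
  · exact hw.le
  · have h1 : (i : ℝ) + 1 ≤ n := by exact_mod_cast hi
    apply Set.Ioc_subset_Ioc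
    · positivity
    · nlinarith

lemma ball_eq {w : ℝ} (hw : 2 * w ≤ 2 * π) (hw0 : 0 < w) (t : TT) :
    μT.real (Metric.closedBall t w) = 2 * w / (2 * π) := by
  rw [muT_eq, Measure.real, AddCircle.volume_closedBall, min_eq_right hw,
    ENNReal.toReal_ofReal (by positivity)]

lemma arc_dist {w : ℝ} {i : ℕ} {t s : TT} (h : t ∈ arc w i) (h' : s ∈ arc w i) : dist t s ≤ w := by
  obtain ⟨a, rfl, ha⟩ := arc_rep h
  obtain ⟨b, rfl, hb⟩ := arc_rep h'
  rw [dist_eq_norm, ← AddCircle.coe_sub]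
  refine (QuotientAddGroup.norm_mk_le_norm).trans ?_
  rw [Real.norm_eq_abs, abs_le]
  constructor <;> linarith [ha.1, ha.2, hb.1, hb.2]

lemma arc_dist' {w : ℝ} {i : ℕ} {t : TT} (h : t ∈ arc w i) :
    dist t (((i : ℝ) * w : ℝ) : TT) ≤ w := by
  obtain ⟨a, rfl, ha⟩ := arc_rep h
  rw [dist_eq_norm, ← AddCircle.coe_sub]
  refine (QuotientAddGroup.norm_mk_le_norm).trans ?_
  rw [Real.norm_eq_abs, abs_le]
  constructor <;> linarith [ha.1, ha.2]

lemma arc_disj {w : ℝ} (hw : 0 < w) {i j : ℕ} {t : TT} (h : t ∈ arc w i) (h' : t ∈ arc w j) :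
    i ≤ j := by
  have h1 := h.1
  have h2 := h'.2
  have : (i : ℝ) < j + 1 := lt_of_mul_lt_mul_right (h1.trans_le h2) hw.le
  have : i < j + 1 := by exact_mod_cast this
  omega

lemma arc_cover {w : ℝ} {n : ℕ} (hw : 0 < w) (hn : n * w = 2 * π) (t : TT) :
    ∃ i < n, t ∈ arc w i := by
  set s : ℝ := ((AddCircle.equivIoc (2 * π) 0 t : Set.Ioc (0 : ℝ) (0 + 2 * π)) : ℝ) with hs
  have hs2 : s ∈ Set.Ioc (0 : ℝ) (0 + 2 * π) := Subtype.coe_prop _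
  have hpos : 0 < s / w := div_pos hs2.1 hw
  have hc : 0 < ⌈s / w⌉₊ := Nat.ceil_pos.2 hpos
  have hle : ⌈s / w⌉₊ ≤ n := by
    apply Nat.ceil_le.2
    rw [div_le_iff₀ hw, hn]; linarith [hs2.2]
  obtain ⟨i, hi⟩ : ∃ i, ⌈s / w⌉₊ = i + 1 := ⟨_, (Nat.succ_pred_eq_of_pos hc).symm⟩
  refine ⟨i, by omega, ?_⟩
  have h1 : s / w ≤ (i : ℝ) + 1 := by
    have := Nat.le_ceil (s / w)
    rw [hi] at this; exact_mod_cast this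
  have h2 : (i : ℝ) < s / w := by
    apply Nat.lt_ceil.1
    omega
  exact ⟨(lt_div_iff₀ hw).1 h2, (div_le_iff₀ hw).1 h1⟩

lemma arc_sum {w : ℝ} {n : ℕ} (hw : 0 < w) (hn : n * w = 2 * π) {B : Set TT}
    (hB : MeasurableSet B) :
    ∑ i ∈ Finset.range n, μT.real (B ∩ arc w i) = μT.real B := by
  rw [← measureReal_biUnion_finset]
  · congr 1
    ext t
    simp only [Set.mem_iUnion, Finset.mem_range, Set.mem_inter_iff, exists_prop]
    constructor
    · rintro ⟨i, -, h, -⟩; exact h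
    · intro h
      obtain ⟨i, hi, hi'⟩ := arc_cover hw hn t
      exact ⟨i, hi, h, hi'⟩
  · intro i _ j _ hij
    refine Set.disjoint_left.2 fun t ht ht' => hij ?_
    exact le_antisymm (arc_disj hw ht.2 ht'.2) (arc_disj hw ht'.2 ht.2)
  · intro i _
    exact hB.inter (arc_meas w i)

/-- The family of bump functions. -/
lemma bumps {D ω : ℝ} (hD : 0 < D) (hω : 0 < ω) :
    ∃ (n : ℕ) (x : ℕ → TT) (φ : ℕ → TT → ℝ) (β : ℕ → ℤ → ℂ),
      (∀ i, Continuous (φ i)) ∧ (∀ i t, 0 ≤ φ i t) ∧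
      (∀ t, ∑ i ∈ Finset.range n, φ i t = 1) ∧
      (∀ t, 1 / 4 ≤ ∑ i ∈ Finset.range n, φ i t ^ 2) ∧
      (∀ i t, φ i t ≠ 0 → dist t (x i) < D) ∧
      (∀ i, Summable fun k => ‖β i k‖) ∧ (∀ i, ∑' k, ‖β i k‖ ≤ 1) ∧
      (∀ i t, HasSum (fun k => β i k * fourier k t) (φ i t : ℂ)) ∧
      (∀ i t p q, D ≤ dist t (x i) →
        ‖∑ k ∈ Finset.Icc p q, β i k * (fourier k t : ℂ)‖ ≤ ω) := by
  obtain ⟨κ, hκ, hκ'⟩ := kappa_exists (half_pos hD)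
  obtain ⟨n, hn⟩ := exists_nat_gt (max 2 (max (8 * (2 * π) / D) (2 / κ / ω)))
  have hn2 : (2 : ℝ) < n := (le_max_left _ _).trans_lt hn
  have hnD : 8 * (2 * π) / D < n := ((le_max_left _ _).trans (le_max_right _ _)).trans_lt hn
  have hnω : 2 / κ / ω < n := ((le_max_right _ _).trans (le_max_right _ _)).trans_lt hn
  have hn0 : (0 : ℝ) < n := by linarith
  set w : ℝ := 2 * π / n with hw
  have hw0 : 0 < w := by positivity
  have hnw : n * w = 2 * π := by rw [hw]; field_simp
  have hw2 : 2 * w ≤ 2 * π := by nlinarith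
  have hwD : 8 * w < D := by
    rw [div_lt_iff₀ hD] at hnD
    rw [hw]
    rw [← mul_div_assoc, div_lt_iff₀ hn0]; linarith
  have hwp : w / (2 * π) = 1 / n := by rw [hw]; field_simp
  set V : ℝ := 2 * w / (2 * π) with hV
  have hV0 : 0 < V := by positivity
  have hVe : V = 2 * (1 / n) := by rw [hV, mul_div_assoc, hwp]
  have hball : ∀ t : TT, μT.real (Metric.closedBall t w) = V := ball_eq hw2 hw0
  have hbm : ∀ t : TT, MeasurableSet (Metric.closedBall t w) := fun t =>
    Metric.isClosed_closedBall.measurableSet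
  let β : ℕ → ℤ → ℂ := fun i k =>
    (starRingEnd ℂ) (fourierCoeff (indC (Metric.closedBall 0 w)) k) *
      fourierCoeff (indC (arc w i)) k / (V : ℂ)
  have hβt : ∀ i t k, β i k * (fourier k t : ℂ) =
      (starRingEnd ℂ) (fourierCoeff (indC (Metric.closedBall t w)) k) *
      fourierCoeff (indC (arc w i)) k / (V : ℂ) := by
    intro i t k
    simp only [β]
    rw [fc_ball t w k, map_mul, ← fourier_neg, neg_neg]
    ring
  let φ : ℕ → TT → ℝ := fun i t => μT.real (Metric.closedBall t w ∩ arc w i) / V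
  have hsum : ∀ i t, HasSum (fun k => β i k * fourier k t) (φ i t : ℂ) := by
    intro i t
    have := (ind_parseval (hbm t) (arc_meas w i)).div_const (V : ℂ)
    simp only [φ]
    push_cast
    convert! this using 2 with k
    exact hβt i t k
  have hβn : ∀ i k, ‖β i k‖ = ‖(starRingEnd ℂ) (fourierCoeff (indC (Metric.closedBall 0 w)) k) *
      fourierCoeff (indC (arc w i)) k‖ / V := by
    intro i k
    simp only [β]
    rw [norm_div, Complex.norm_real, Real.norm_of_nonneg hV0.le]
  have hsm : ∀ i, Summable fun k => ‖β i k‖ := by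
    intro i
    simp_rw [hβn]
    exact (ind_summable (hbm 0) (arc_meas w i)).1.div_const V
  have hle1 : ∀ i, ∑' k, ‖β i k‖ ≤ 1 := by
    intro i
    simp_rw [hβn]
    rw [tsum_div_const, div_le_one hV0]
    refine (ind_summable (hbm 0) (arc_meas w i)).2.trans ?_
    have := arc_le hw0 i
    rw [hball, hVe]
    rw [hwp] at this
    have : 0 < 1 / (n : ℝ) := by positivity
    linarith
  refine ⟨n, fun i => (((i : ℝ) * w : ℝ) : TT), φ, β, ?_, ?_, ?_, ?_, ?_, hsm, hle1, hsum, ?_⟩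
  · intro i
    have h1 : Continuous fun t : TT => ∑' k, β i k * (fourier k t : ℂ) := by
      refine continuous_tsum (fun k => by fun_prop) (hsm i) fun k t => ?_
      rw [norm_mul, norm_fourier, mul_one]
    have h2 : (fun t : TT => ∑' k, β i k * (fourier k t : ℂ)) = fun t => (φ i t : ℂ) :=
      funext fun t => (hsum i t).tsum_eq
    rw [h2] at h1
    exact Complex.continuous_re.comp h1
  · intro i t
    simp only [φ]; positivity
  · intro t
    simp only [φ]
    rw [← Finset.sum_div, arc_sum hw0 hnw (hbm t), hball, div_self hV0.ne']
  · intro t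
    obtain ⟨i, hi, hit⟩ := arc_cover hw0 hnw t
    have hφ : φ i t = 1 / 2 := by
      simp only [φ]
      rw [Set.inter_eq_right.2, arc_eq hw0 hnw hi, hwp, hVe]
      · field_simp
      · intro s hs
        exact arc_dist hs hit
    calc (1 / 4 : ℝ) = φ i t ^ 2 := by rw [hφ]; norm_num
      _ ≤ _ := Finset.single_le_sum (f := fun i => φ i t ^ 2) (fun j _ => sq_nonneg _)
        (Finset.mem_range.2 hi)
  · intro i t h
    have : (Metric.closedBall t w ∩ arc w i).Nonempty := by
      by_contra hne
      rw [Set.not_nonempty_iff_eq_empty] at hne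
      apply h
      simp [φ, hne]
    obtain ⟨s, hs1, hs2⟩ := this
    have h1 := arc_dist' hs2
    rw [Metric.mem_closedBall, dist_comm] at hs1
    have := dist_triangle t s (((i : ℝ) * w : ℝ) : TT)
    linarith
  · intro i t p q hd
    simp_rw [hβt]
    rw [← Finset.sum_div, norm_div, Complex.norm_real, Real.norm_of_nonneg hV0.le, div_le_iff₀ hV0]
    have := window_far (hbm t) (arc_meas w i) hκ (fun y hy s hs => hκ' _ ?_) p q
    · refine this.trans ?_
      rw [hball]
      have h1 := arc_le hw0 i
      rw [hwp] at h1
      gcongr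
      calc 2 / κ * μT.real (arc w i) ≤ 2 / κ * (1 / n) := by gcongr
        _ ≤ ω := by
          rw [mul_one_div, div_le_iff₀ hn0]
          rw [div_lt_iff₀ hω] at hnω
          linarith
    · rw [← dist_eq_norm]
      have h1 := arc_dist' hs
      rw [Metric.mem_closedBall] at hy
      have h2 := dist_triangle t y (((i : ℝ) * w : ℝ) : TT)
      have h3 := dist_triangle y s (((i : ℝ) * w : ℝ) : TT)
      rw [dist_comm] at hy
      linarith

end ArMen


namespace ArMen

/-- Symmetric partial sums. -/
noncomputable def PS (c : ℤ → ℂ) (N : ℕ) (t : TT) : ℂ :=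
  ∑ k ∈ Finset.Icc (-(N : ℤ)) (N : ℤ), c k * fourier k t

/-- Coefficients supported in `Λ` and in the block from `M` to the second index. -/
def Blk (Λ : Set ℤ) (M M' : ℕ) (c : ℤ → ℂ) : Prop :=
  ∀ k, c k ≠ 0 → k ∈ Λ ∧ (M : ℤ) < |k| ∧ |k| ≤ M'

lemma PS_add (c d : ℤ → ℂ) (N : ℕ) (t : TT) : PS (c + d) N t = PS c N t + PS d N t := by
  simp [PS, add_mul, Finset.sum_add_distrib, -fourier_apply]

lemma PS_cont (c : ℤ → ℂ) (N : ℕ) : Continuous (PS c N) := by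
  unfold PS; fun_prop

lemma PS_low {Λ : Set ℤ} {M M' : ℕ} {c : ℤ → ℂ} (h : Blk Λ M M' c) {N : ℕ} (hN : N ≤ M) (t : TT) :
    PS c N t = 0 := by
  refine Finset.sum_eq_zero fun k hk => ?_
  have : c k = 0 := by
    by_contra hne
    have := (h k hne).2.1
    rw [Finset.mem_Icc] at hk
    have := abs_le.2 hk
    omega
  rw [this, zero_mul]

lemma PS_high {Λ : Set ℤ} {M M' : ℕ} {c : ℤ → ℂ} (h : Blk Λ M M' c) {N : ℕ} (hN : M' ≤ N)
    (t : TT) : PS c N t = PS c M' t := by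
  symm
  refine Finset.sum_subset (Finset.Icc_subset_Icc (by omega) (by omega)) fun k _ hk => ?_
  have : c k = 0 := by
    by_contra hne
    have := (h k hne).2.2
    exact hk (Finset.mem_Icc.2 (abs_le.1 this))
  rw [this, zero_mul]

lemma Blk_add {Λ : Set ℤ} {M M' M'' : ℕ} {c d : ℤ → ℂ} (hc : Blk Λ M M' c) (hd : Blk Λ M' M'' d)
    (h1 : M ≤ M') (h2 : M' ≤ M'') : Blk Λ M M'' (c + d) := by
  intro k hk
  by_cases h : c k = 0
  · have hdk : d k ≠ 0 := by
      intro h'; apply hk; simp [h, h']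
    obtain ⟨a, b, e⟩ := hd k hdk
    exact ⟨a, by omega, e⟩
  · obtain ⟨a, b, e⟩ := hc k h
    exact ⟨a, b, by omega⟩

lemma PS_concat_low {Λ : Set ℤ} {M' M'' : ℕ} {c d : ℤ → ℂ}
    (hd : Blk Λ M' M'' d) {N : ℕ} (hN : N ≤ M') (t : TT) : PS (c + d) N t = PS c N t := by
  rw [PS_add, PS_low hd hN, add_zero]

lemma PS_concat_high {Λ : Set ℤ} {M M' : ℕ} {c d : ℤ → ℂ} (hc : Blk Λ M M' c)
    {N : ℕ} (hN : M' ≤ N) (t : TT) : PS (c + d) N t = PS c M' t + PS d N t := by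
  rw [PS_add, PS_high hc hN]

/-- The property of `Λ` that is used. -/
def Good (Λ : Set ℤ) : Prop :=
  ∀ M L : ℕ, ∃ a : ℕ, M + L < a ∧ ∀ l : ℤ, |l| ≤ L → (a : ℤ) + l ∈ Λ ∧ -(a : ℤ) + l ∈ Λ

lemma good_of {Λ : Set ℤ} (hsymm : ∀ k : ℤ, k ∈ Λ ↔ -k ∈ Λ)
    (hseg : ∀ L : ℕ, ∃ a : ℤ, ∀ i : ℕ, i ≤ L → a + (i : ℤ) ∈ Λ) : Good Λ := by
  intro M L
  obtain ⟨b, hb⟩ := hseg (2 * (M + 2 * L + 1))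
  have hb' : ∀ j : ℤ, b ≤ j → j ≤ b + 2 * (M + 2 * L + 1) → j ∈ Λ := by
    intro j h1 h2
    have := hb (j - b).toNat (by omega)
    rwa [show b + ((j - b).toNat : ℤ) = j by omega] at this
  have key : ∃ a : ℕ, M + L < a ∧ ∀ l : ℤ, |l| ≤ L → (a : ℤ) + l ∈ Λ := by
    by_cases h : 0 ≤ b + (M + 2 * L + 1)
    · refine ⟨(b + 2 * (M + 2 * L + 1) - L).toNat, by omega, fun l hl => ?_⟩
      rw [abs_le] at hl
      apply hb' <;> omega
    · refine ⟨(-(b + L)).toNat, by omega, fun l hl => ?_⟩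
      rw [abs_le] at hl
      rw [hsymm]
      apply hb' <;> omega
  obtain ⟨a, ha, hal⟩ := key
  refine ⟨a, ha, fun l hl => ⟨hal l hl, ?_⟩⟩
  rw [hsymm, neg_add, neg_neg]
  exact hal _ (by rwa [abs_neg])

/-- `cos (a t)`. -/
noncomputable def cosT (a : ℕ) (t : TT) : ℝ := (fourier (a : ℤ) t : ℂ).re

lemma cosT_cont (a : ℕ) : Continuous (cosT a) := by
  unfold cosT; fun_prop

lemma cosT_le (a : ℕ) (t : TT) : |cosT a t| ≤ 1 := by
  rw [← norm_fourier (a : ℤ) t]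
  exact Complex.abs_re_le_norm _

lemma two_cosT (a : ℕ) (t : TT) :
    (fourier (a : ℤ) t : ℂ) + fourier (-(a : ℤ)) t = 2 * (cosT a t : ℂ) := by
  rw [fourier_neg, Complex.add_conj, cosT, Complex.ofReal_mul]
  rfl

lemma shift_sum (γ : ℤ → ℂ) (a p q : ℤ) (t : TT) :
    ∑ k ∈ Finset.Icc p q, γ (k - a) * (fourier k t : ℂ) =
      fourier a t * ∑ l ∈ Finset.Icc (p - a) (q - a), γ l * (fourier l t : ℂ) := by
  rw [Finset.mul_sum]
  refine Finset.sum_nbij' (fun k => k - a) (fun l => l + a) ?_ ?_ ?_ ?_ ?_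
  · intro k hk; rw [Finset.mem_Icc] at *; omega
  · intro k hk; rw [Finset.mem_Icc] at *; omega
  · intro k _; ring
  · intro k _; ring
  · intro k _
    have : (fourier k t : ℂ) = fourier a t * fourier (k - a) t := by
      rw [← fourier_add]; congr 2; ring
    rw [this]; ring

lemma trunc_sum (β : ℤ → ℂ) (m p q : ℤ) (t : TT) :
    ∑ l ∈ Finset.Icc p q, (if |l| ≤ m then β l else 0) * (fourier l t : ℂ) =
      ∑ l ∈ Finset.Icc (max p (-m)) (min q m), β l * (fourier l t : ℂ) := by
  simp_rw [ite_mul, zero_mul]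
  rw [← Finset.sum_filter]
  refine Finset.sum_congr ?_ fun _ _ => rfl
  ext l
  simp only [Finset.mem_filter, Finset.mem_Icc, abs_le]
  omega

lemma tail_bd {β : ℤ → ℂ} (hβ : Summable fun k => ‖β k‖) {φ : TT → ℂ}
    (hφ : ∀ t, HasSum (fun k => β k * fourier k t) (φ t)) {τ : ℝ} (hτ : 0 < τ) :
    ∃ m : ℕ, ∀ t, ‖φ t - ∑ l ∈ Finset.Icc (-(m : ℤ)) m, β l * (fourier l t : ℂ)‖ ≤ τ := by
  obtain ⟨s, hs⟩ := summable_iff_vanishing_norm.1 hβ τ hτ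
  obtain ⟨m, hm⟩ : ∃ m : ℕ, s ⊆ Finset.Icc (-(m : ℤ)) m := by
    refine ⟨∑ k ∈ s, k.natAbs, fun k hk => ?_⟩
    have := Finset.single_le_sum (f := Int.natAbs) (fun i _ => Nat.zero_le _) hk
    rw [Finset.mem_Icc]; omega
  refine ⟨m, fun t => ?_⟩
  set I := Finset.Icc (-(m : ℤ)) (m : ℤ)
  have ht : Tendsto (fun S : Finset ℤ => ‖∑ k ∈ S, β k * (fourier k t : ℂ) -
      ∑ l ∈ I, β l * (fourier l t : ℂ)‖) atTop
      (𝓝 ‖φ t - ∑ l ∈ I, β l * (fourier l t : ℂ)‖) :=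
    (Tendsto.sub_const (hφ t) _).norm
  refine le_of_tendsto ht ?_
  filter_upwards [eventually_ge_atTop I] with S hS
  rw [← Finset.sum_sdiff hS, add_sub_cancel_right]
  have h1 := hs (S \ I) (Finset.disjoint_left.2 fun k hk hk' =>
    (Finset.mem_sdiff.1 hk).2 (hm hk'))
  refine le_trans ?_ h1.le
  refine (norm_sum_le _ _).trans (le_trans (le_of_eq ?_) (Real.le_norm_self _))
  refine Finset.sum_congr rfl fun k _ => ?_
  rw [norm_mul, norm_fourier, mul_one]

lemma atom {Λ : Set ℤ} (hΛ : Good Λ) {β : ℤ → ℂ} (hβ : Summable fun k => ‖β k‖) {φ : TT → ℝ}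
    (hφ : ∀ t, HasSum (fun k => β k * fourier k t) (φ t : ℂ)) {τ : ℝ} (hτ : 0 < τ) (z : ℂ)
    (M : ℕ) (G : ℕ → Prop) (hG : ∀ᶠ a in atTop, G a) :
    ∃ (a M' : ℕ) (d : ℤ → ℂ), G a ∧ M ≤ M' ∧ Blk Λ M M' d ∧
      (∀ t, ‖PS d M' t - z * ((φ t * cosT a t : ℝ) : ℂ)‖ ≤ τ) ∧
      ∀ (t : TT) (B : ℝ), (∀ p q : ℤ, ‖∑ k ∈ Finset.Icc p q, β k * (fourier k t : ℂ)‖ ≤ B) →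
        ∀ N, ‖PS d N t‖ ≤ ‖z‖ * B := by
  obtain ⟨m, hm⟩ := tail_bd hβ hφ (τ := τ / (‖z‖ + 1)) (by positivity)
  obtain ⟨a0, ha0⟩ := eventually_atTop.1 hG
  obtain ⟨a, ha, hal⟩ := hΛ (M + a0) m
  let γ : ℤ → ℂ := fun l => if |l| ≤ (m : ℤ) then β l else 0
  let d : ℤ → ℂ := fun k => z / 2 * (γ (k - a) + γ (k - (-(a : ℤ))))
  have hPS : ∀ N t, PS d N t = z / 2 * (fourier (a : ℤ) t *
      ∑ l ∈ Finset.Icc (max (-(N : ℤ) - a) (-m)) (min (N - a) (m : ℤ)), β l * (fourier l t : ℂ) +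
      fourier (-(a : ℤ)) t *
      ∑ l ∈ Finset.Icc (max (-(N : ℤ) - (-(a : ℤ))) (-m)) (min (N - (-(a : ℤ))) (m : ℤ)),
        β l * (fourier l t : ℂ)) := by
    intro N t
    rw [← trunc_sum, ← trunc_sum, ← shift_sum γ, ← shift_sum γ, ← Finset.sum_add_distrib,
      Finset.mul_sum]
    refine Finset.sum_congr rfl fun k _ => ?_
    simp only [d]
    ring
  refine ⟨a, a + m, d, ha0 a (by omega), by omega, ?_, ?_, ?_⟩
  · intro k hk
    have h : |k - a| ≤ m ∨ |k - (-(a : ℤ))| ≤ m := by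
      by_contra hcon
      push Not at hcon
      apply hk
      simp only [d, γ]
      rw [if_neg (not_le.2 hcon.1), if_neg (not_le.2 hcon.2)]
      simp
    rcases h with h | h
    · have h1 := (hal _ h).1
      rw [add_sub_cancel] at h1
      refine ⟨h1, ?_⟩
      rw [abs_le] at h
      rw [abs_of_pos (by omega)]
      push_cast
      omega
    · have h1 := (hal _ h).2
      rw [add_sub_cancel] at h1
      refine ⟨h1, ?_⟩
      rw [abs_le] at h
      rw [abs_of_neg (by omega)]
      push_cast
      omega
  · intro t
    have e1 : max (-((a + m : ℕ) : ℤ) - a) (-m) = -(m : ℤ) := by push_cast; omega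
    have e2 : min (((a + m : ℕ) : ℤ) - a) (m : ℤ) = m := by push_cast; omega
    have e3 : max (-((a + m : ℕ) : ℤ) - (-(a : ℤ))) (-m) = -(m : ℤ) := by push_cast; omega
    have e4 : min (((a + m : ℕ) : ℤ) - (-(a : ℤ))) (m : ℤ) = m := by push_cast; omega
    rw [hPS, e1, e2, e3, e4, ← add_mul, two_cosT]
    have h := hm t
    set F := ∑ l ∈ Finset.Icc (-(m : ℤ)) m, β l * (fourier l t : ℂ)
    have : z / 2 * (2 * (cosT a t : ℂ) * F) - z * ((φ t * cosT a t : ℝ) : ℂ) =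
        z * (cosT a t : ℂ) * -((φ t : ℂ) - F) := by push_cast; ring
    rw [this, norm_mul, norm_mul, norm_neg, Complex.norm_real, Real.norm_eq_abs]
    calc ‖z‖ * |cosT a t| * ‖(φ t : ℂ) - F‖ ≤ ‖z‖ * 1 * (τ / (‖z‖ + 1)) := by
          gcongr
          exact cosT_le a t
      _ ≤ τ := by
        rw [mul_one, ← mul_div_assoc, div_le_iff₀ (by positivity)]
        nlinarith [norm_nonneg z]
  · intro t B hB N
    rw [hPS, norm_mul, norm_div, Complex.norm_ofNat]
    have : ∀ {X Y : ℂ}, ‖X‖ ≤ B → ‖Y‖ ≤ B →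
        ‖(fourier (a : ℤ) t : ℂ) * X + fourier (-(a : ℤ)) t * Y‖ ≤ 2 * B := by
      intro X Y hX hY
      refine (norm_add_le _ _).trans ?_
      rw [norm_mul, norm_mul, norm_fourier, norm_fourier]
      linarith
    calc _ ≤ ‖z‖ / 2 * (2 * B) := by
          gcongr
          exact this (hB _ _) (hB _ _)
      _ = ‖z‖ * B := by ring

lemma riemann_lebesgue {u : TT → ℝ} (hu : Continuous u) :
    Tendsto (fun a : ℕ => ∫ t, u t * cosT a t ∂μT) atTop (𝓝 0) := by
  let f : C(TT, ℂ) := ⟨fun t => (u t : ℂ), by fun_prop⟩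
  have hs := (hasSum_sq_fourierCoeff (ContinuousMap.toLp (E := ℂ) 2 μT ℂ f)).summable
  simp_rw [fourierCoeff_toLp] at hs
  have h0 := hs.tendsto_cofinite_zero
  have hinj : Function.Injective (fun a : ℕ => -(a : ℤ)) := by
    intro a b h
    simpa using h
  have h1 := h0.comp (hinj.tendsto_cofinite)
  rw [Nat.cofinite_eq_atTop] at h1
  have h2 : Tendsto (fun a : ℕ => ‖fourierCoeff f (-(a : ℤ))‖) atTop (𝓝 0) := by
    have := h1.sqrt
    simpa [Function.comp_def] using this
  refine squeeze_zero_norm (fun a => ?_) h2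
  have h3 : ∫ t, u t * cosT a t ∂μT = (fourierCoeff f (-(a : ℤ))).re := by
    rw [fourierCoeff, ← RCLike.re_eq_complex_re, ← integral_re]
    · congr 1
      ext t
      simp [f, cosT, -fourier_apply, mul_comm]
    · refine Continuous.integrable_of_hasCompactSupport ?_ (HasCompactSupport.of_compactSpace _)
      exact (map_continuous (fourier (-(-(a : ℤ))))).smul (map_continuous f)
  rw [h3]
  exact Complex.abs_re_le_norm _

lemma cosT_sq (a : ℕ) (t : TT) : cosT a t ^ 2 = 1 / 2 + cosT (2 * a) t / 2 := by
  have h : (fourier ((2 * a : ℕ) : ℤ) t : ℂ) = fourier (a : ℤ) t * fourier (a : ℤ) t := by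
    rw [← fourier_add]; congr 2; push_cast; ring
  have h2 := norm_fourier (a : ℤ) t
  have h3 := Complex.sq_norm (fourier (a : ℤ) t : ℂ)
  rw [h2, Complex.normSq_apply] at h3
  unfold cosT
  rw [h, Complex.mul_re]
  linarith

lemma int_cont {u : TT → ℝ} (hu : Continuous u) : Integrable u μT :=
  hu.integrable_of_hasCompactSupport (HasCompactSupport.of_compactSpace _)

end ArMen


namespace ArMen

lemma rl_ev {u : TT → ℝ} (hu : Continuous u) {τ : ℝ} (hτ : 0 < τ) :
    ∀ᶠ a : ℕ in atTop, |∫ t, u t * cosT a t ∂μT| ≤ τ := by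
  have h := (riemann_lebesgue hu).eventually (Metric.closedBall_mem_nhds 0 hτ)
  filter_upwards [h] with a ha
  simpa [Real.dist_eq] using ha

lemma rl_ev2 {u : TT → ℝ} (hu : Continuous u) {τ : ℝ} (hτ : 0 < τ) :
    ∀ᶠ a : ℕ in atTop, |∫ t, u t * cosT (2 * a) t ∂μT| ≤ τ :=
  (tendsto_id.const_mul_atTop' (two_pos : (0 : ℕ) < 2)).eventually (rl_ev hu hτ)

lemma window_one {β : ℤ → ℂ} (hβ : Summable fun k => ‖β k‖) (h1 : ∑' k, ‖β k‖ ≤ 1) (t : TT)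
    (p q : ℤ) : ‖∑ k ∈ Finset.Icc p q, β k * (fourier k t : ℂ)‖ ≤ 1 := by
  refine (norm_sum_le _ _).trans (le_trans ?_ h1)
  refine le_trans (le_of_eq ?_) (hβ.sum_le_tsum (Finset.Icc p q) (fun _ _ => norm_nonneg _))
  refine Finset.sum_congr rfl fun k _ => ?_
  rw [norm_mul, norm_fourier, mul_one]

lemma round {Λ : Set ℤ} (hΛ : Good Λ) {Q : TT → ℂ} (hQ : Continuous Q) {u₁ u₂ v : TT → ℝ}
    (hu₁ : Continuous u₁) (hu₂ : Continuous u₂) (hv : Continuous v) (hv0 : ∀ t, 0 ≤ v t)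
    {θ : ℝ} (hθ : 0 < θ) (M : ℕ) :
    ∃ (c : ℤ → ℂ) (M' : ℕ) (ψ : TT → ℝ), M ≤ M' ∧ Blk Λ M M' c ∧ Continuous ψ ∧
      (∀ t, |ψ t| ≤ 1) ∧ (∀ t, ‖PS c M' t - Q t * (ψ t : ℂ)‖ ≤ θ) ∧
      (∀ t N, ‖PS c N t‖ ≤ 2 * ‖Q t‖ + θ) ∧ |∫ t, u₁ t * ψ t ∂μT| ≤ θ ∧
      |∫ t, u₂ t * ψ t ∂μT| ≤ θ ∧ (1 / 8) * ∫ t, v t ∂μT - θ ≤ ∫ t, v t * ψ t ^ 2 ∂μT := by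
  obtain ⟨ω, hω⟩ : ∃ ω : ℝ, ω = θ / 4 := ⟨_, rfl⟩
  have hω0 : 0 < ω := by rw [hω]; positivity
  obtain ⟨K, hK0, hK⟩ : ∃ K : ℝ, 0 < K ∧ ∀ t, ‖Q t‖ ≤ K := by
    obtain ⟨K, hK⟩ := (isCompact_range hQ).isBounded.exists_norm_le
    exact ⟨max K 1, by positivity, fun t => (hK _ ⟨t, rfl⟩).trans (le_max_left _ _)⟩
  obtain ⟨D, hD, hunif⟩ := Metric.uniformContinuous_iff.1
    (CompactSpace.uniformContinuous_of_continuous hQ) ω hω0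
  obtain ⟨n, x, φ, β, hφc, hφ0, hφ1, hφ2, hφD, hβs, hβ1, hβφ, hβf⟩ :=
    bumps hD (show 0 < ω / K by positivity)
  obtain ⟨τ, hτ⟩ : ∃ τ : ℝ, τ = θ / (2 * (n + 1)) := ⟨_, rfl⟩
  have hτ0 : 0 < τ := by rw [hτ]; positivity
  have hnτ : n * τ ≤ θ / 2 := by
    have : (n + 1) * τ = θ / 2 := by rw [hτ]; field_simp
    nlinarith
  have hS1 : ∀ i ≤ n, ∀ t, ∑ j ∈ Finset.range i, φ j t ≤ 1 := by
    intro i hi t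
    rw [← hφ1 t]
    exact Finset.sum_le_sum_of_subset_of_nonneg (Finset.range_subset_range.2 hi)
      fun _ _ _ => hφ0 _ _
  have key : ∀ i ≤ n, ∃ (c : ℤ → ℂ) (M' : ℕ) (ψ : TT → ℝ), M ≤ M' ∧ Blk Λ M M' c ∧ Continuous ψ ∧
      (∀ t, |ψ t| ≤ ∑ j ∈ Finset.range i, φ j t) ∧
      (∀ t, ‖PS c M' t - Q t * (ψ t : ℂ)‖ ≤ ω * (∑ j ∈ Finset.range i, φ j t) + i * τ) ∧
      (∀ t N, ‖PS c N t‖ ≤ 2 * ‖Q t‖ + 2 * ω + i * τ) ∧ |∫ t, u₁ t * ψ t ∂μT| ≤ i * τ ∧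
      |∫ t, u₂ t * ψ t ∂μT| ≤ i * τ ∧
      (1 / 2) * ∫ t, v t * (∑ j ∈ Finset.range i, φ j t ^ 2) ∂μT - i * τ
        ≤ ∫ t, v t * ψ t ^ 2 ∂μT := by
    intro i
    induction i with
    | zero =>
      intro _
      have hz : ∀ N t, PS (0 : ℤ → ℂ) N t = 0 := by intro N t; simp [PS]
      refine ⟨0, M, 0, le_rfl, ?_, continuous_zero, ?_, ?_, ?_, ?_, ?_, ?_⟩
      · intro k hk; exact absurd rfl hk
      · intro t; simp
      · intro t; simp [hz]
      · intro t N; rw [hz]; simp; positivity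
      · simp
      · simp
      · simp
    | succ i ih =>
      intro hi
      obtain ⟨c, M₁, ψ, hM₁, hB, hψc, hψ, happ, hmax, h1, h2, h3⟩ := ih (by omega)
      obtain ⟨a, M₂, d, ⟨g1, g2, g3, g4⟩, hM₂, hBd, hd, hdN⟩ := atom hΛ (hβs i) (hβφ i) hτ0 (Q (x i))
        M₁ (fun a => |∫ t, (u₁ t * φ i t) * cosT a t ∂μT| ≤ τ ∧
          |∫ t, (u₂ t * φ i t) * cosT a t ∂μT| ≤ τ ∧
          |∫ t, (2 * v t * ψ t * φ i t) * cosT a t ∂μT| ≤ τ / 2 ∧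
          |∫ t, (v t * φ i t ^ 2) * cosT (2 * a) t ∂μT| ≤ τ)
        (by
          have := hφc i
          exact (rl_ev (by fun_prop) hτ0).and ((rl_ev (by fun_prop) hτ0).and
            ((rl_ev (by fun_prop) (by positivity)).and (rl_ev2 (by fun_prop) hτ0))))
      have hφi := hφc i
      have hcos := cosT_cont a
      have hcos2 := cosT_cont (2 * a)
      have hoff : ∀ t, ‖Q (x i) - Q t‖ * φ i t ≤ ω * φ i t := by
        intro t
        by_cases h0 : φ i t = 0
        · simp [h0]
        · have := hunif (hφD i t h0)
          rw [dist_comm, dist_eq_norm] at this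
          exact mul_le_mul_of_nonneg_right this.le (hφ0 i t)
      have hlin : ∀ u : TT → ℝ, Continuous u → |∫ t, (u t * φ i t) * cosT a t ∂μT| ≤ τ →
          |∫ t, u t * ψ t ∂μT| ≤ i * τ →
          |∫ t, u t * (ψ t + φ i t * cosT a t) ∂μT| ≤ (i + 1) * τ := by
        intro u hu ha hb
        have : ∫ t, u t * (ψ t + φ i t * cosT a t) ∂μT =
            ∫ t, u t * ψ t ∂μT + ∫ t, (u t * φ i t) * cosT a t ∂μT := by
          rw [← integral_add (int_cont (by fun_prop)) (int_cont (by fun_prop))]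
          congr 1; ext t; ring
        rw [this]
        refine (abs_add_le _ _).trans ?_
        linarith
      refine ⟨c + d, M₂, fun t => ψ t + φ i t * cosT a t, hM₁.trans hM₂, Blk_add hB hBd hM₁ hM₂,
        by fun_prop, ?_, ?_, ?_, ?_, ?_, ?_⟩
      · intro t
        rw [Finset.sum_range_succ]
        refine (abs_add_le _ _).trans (add_le_add (hψ t) ?_)
        rw [abs_mul, abs_of_nonneg (hφ0 i t)]
        exact mul_le_of_le_one_right (hφ0 i t) (cosT_le a t)
      · intro t
        rw [Finset.sum_range_succ, PS_concat_high hB hM₂]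
        have e : PS c M₁ t + PS d M₂ t - Q t * ((ψ t + φ i t * cosT a t : ℝ) : ℂ) =
          (PS c M₁ t - Q t * (ψ t : ℂ)) + (PS d M₂ t - Q (x i) * ((φ i t * cosT a t : ℝ) : ℂ)) +
            (Q (x i) - Q t) * ((φ i t * cosT a t : ℝ) : ℂ) := by push_cast; ring
        rw [e]
        refine (norm_add₃_le).trans ?_
        have b1 : ‖(Q (x i) - Q t) * ((φ i t * cosT a t : ℝ) : ℂ)‖ ≤ ω * φ i t := by
          rw [norm_mul, Complex.norm_real, Real.norm_eq_abs, abs_mul, abs_of_nonneg (hφ0 i t)]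
          refine le_trans ?_ (hoff t)
          refine mul_le_mul_of_nonneg_left ?_ (norm_nonneg _)
          exact mul_le_of_le_one_right (hφ0 i t) (cosT_le a t)
        have := happ t
        have := hd t
        push_cast at *
        linarith
      · intro t N
        push_cast
        rcases le_total N M₁ with hN | hN
        · rw [PS_concat_low hBd hN]
          have := hmax t N
          linarith
        · rw [PS_concat_high hB hN]
          have b1 : ‖PS c M₁ t‖ ≤ ‖Q t‖ + ω + i * τ := by
            have e : PS c M₁ t = (PS c M₁ t - Q t * (ψ t : ℂ)) + Q t * (ψ t : ℂ) := by ring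
            rw [e]
            refine (norm_add_le _ _).trans ?_
            have s1 := hS1 i (by omega) t
            have s2 : ‖Q t * (ψ t : ℂ)‖ ≤ ‖Q t‖ := by
              rw [norm_mul, Complex.norm_real, Real.norm_eq_abs]
              exact mul_le_of_le_one_right (norm_nonneg _) ((hψ t).trans s1)
            have := happ t
            nlinarith
          have b2 : ‖PS d N t‖ ≤ ‖Q t‖ + ω := by
            by_cases hdist : D ≤ dist t (x i)
            · have := hdN t (ω / K) (fun p q => hβf i t p q hdist) N
              have h5 : ‖Q (x i)‖ * (ω / K) ≤ K * (ω / K) :=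
                mul_le_mul_of_nonneg_right (hK _) (by positivity)
              rw [mul_div_cancel₀ _ hK0.ne'] at h5
              have := norm_nonneg (Q t)
              linarith
            · have := hdN t 1 (fun p q => window_one (hβs i) (hβ1 i) t p q) N
              have h6 := hunif (not_le.1 hdist)
              rw [dist_comm, dist_eq_norm] at h6
              have h7 := norm_sub_norm_le (Q (x i)) (Q t)
              linarith
          have := norm_add_le (PS c M₁ t) (PS d N t)
          linarith
      · push_cast; exact hlin u₁ hu₁ g1 h1
      · push_cast; exact hlin u₂ hu₂ g2 h2
      · have e1 : ∫ t, v t * (∑ j ∈ Finset.range (i + 1), φ j t ^ 2) ∂μT =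
            ∫ t, v t * (∑ j ∈ Finset.range i, φ j t ^ 2) ∂μT + ∫ t, v t * φ i t ^ 2 ∂μT := by
          rw [← integral_add (int_cont (by fun_prop)) (int_cont (by fun_prop))]
          congr 1; ext t; rw [Finset.sum_range_succ]; ring
        have e2 : ∫ t, v t * (ψ t + φ i t * cosT a t) ^ 2 ∂μT =
            ((∫ t, v t * ψ t ^ 2 ∂μT + ∫ t, (2 * v t * ψ t * φ i t) * cosT a t ∂μT) +
              ∫ t, (1 / 2) * (v t * φ i t ^ 2) ∂μT) +
              ∫ t, (1 / 2) * ((v t * φ i t ^ 2) * cosT (2 * a) t) ∂μT := by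
          rw [← integral_add (int_cont (by fun_prop)) (int_cont (by fun_prop)),
            ← integral_add (int_cont (by fun_prop)) (int_cont (by fun_prop)),
            ← integral_add (int_cont (by fun_prop)) (int_cont (by fun_prop))]
          congr 1; ext t
          have := cosT_sq a t
          linear_combination (v t * φ i t ^ 2) * this
        rw [integral_const_mul, integral_const_mul] at e2
        rw [e1, e2]
        have := (abs_le.1 g3).1
        have := (abs_le.1 g4).1
        push_cast
        linarith
  obtain ⟨c, M', ψ, hM, hB, hψc, hψ, happ, hmax, h1, h2, h3⟩ := key n le_rfl
  refine ⟨c, M', ψ, hM, hB, hψc, ?_, ?_, ?_, ?_, ?_, ?_⟩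
  · intro t; rw [← hφ1 t]; exact hψ t
  · intro t; have := happ t; rw [hφ1] at this; linarith
  · intro t N; have := hmax t N; linarith
  · linarith
  · linarith
  · have : ∫ t, (1 / 4) * v t ∂μT ≤ ∫ t, v t * (∑ j ∈ Finset.range n, φ j t ^ 2) ∂μT := by
      refine integral_mono (int_cont (by fun_prop)) (int_cont (by fun_prop)) fun t => ?_
      have := hφ2 t
      have := hv0 t
      simp only
      nlinarith
    rw [integral_const_mul] at this
    linarith

end ArMen

namespace ArMen

lemma main_lemma {Λ : Set ℤ} (hΛ : Good Λ) {ε : ℝ} (hε : 0 < ε) : ∃ A : ℝ, 0 < A ∧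
    ∀ g : TT → ℂ, Continuous g → ∀ η : ℝ, 0 < η → ∀ M : ℕ,
    ∃ (c : ℤ → ℂ) (M' : ℕ), M ≤ M' ∧ Blk Λ M M' c ∧
      μT.real {t | η < ‖PS c M' t - g t‖} ≤ ε ∧ ∀ t N, ‖PS c N t‖ ≤ A * ‖g t‖ + η := by
  obtain ⟨R, hR⟩ : ∃ R : ℝ, R = 8 / ε + 1 := ⟨_, rfl⟩
  have hR1 : 1 ≤ R := by rw [hR]; have : 0 < 8 / ε := by positivity
                         linarith
  have hRε : 8 ≤ R * ε := by
    have : R * ε = 8 + ε := by rw [hR]; field_simp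
    linarith
  refine ⟨3 * R, by positivity, fun g hg η hη M => ?_⟩
  obtain ⟨K, hK0, hK⟩ : ∃ K : ℝ, 0 < K ∧ ∀ t, ‖g t‖ ≤ K := by
    obtain ⟨K, hK⟩ := (isCompact_range hg).isBounded.exists_norm_le
    exact ⟨max K 1, by positivity, fun t => (hK _ ⟨t, rfl⟩).trans (le_max_left _ _)⟩
  obtain ⟨s, hs0, hsR, hsK⟩ : ∃ s : ℝ, 0 < s ∧ s ≤ R / 2 ∧ s * K ≤ η / 2 := by
    refine ⟨min (R / 2) (η / 2 / K), lt_min (by positivity) (by positivity), min_le_left _ _, ?_⟩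
    rw [← le_div_iff₀ hK0]; exact min_le_right _ _
  obtain ⟨κ, hκ⟩ : ∃ κ : ℝ, κ = s ^ 2 * (ε / 2) := ⟨_, rfl⟩
  have hκ0 : 0 < κ := by rw [hκ]; positivity
  obtain ⟨J, hJ⟩ := exists_nat_gt (R ^ 2 / (κ / 16))
  have hJ' : R ^ 2 < J * (κ / 16) := by rwa [div_lt_iff₀ (by positivity)] at hJ
  obtain ⟨θ, hθ0, hθκ, hθ1, hθη⟩ : ∃ θ : ℝ, 0 < θ ∧ 3 * θ ≤ κ / 16 ∧ (J + 1) * θ ≤ 1 ∧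
      (J + 1) * θ ≤ η / 2 := by
    refine ⟨min (κ / 48) (min (1 / (J + 1)) (η / 2 / (J + 1))), ?_, ?_, ?_, ?_⟩
    · refine lt_min (by positivity) (lt_min (by positivity) (by positivity))
    · have := min_le_left (κ / 48) (min (1 / ((J : ℝ) + 1)) (η / 2 / (J + 1)))
      linarith
    · rw [mul_comm, ← le_div_iff₀ (by positivity)]
      exact (min_le_right _ _).trans (min_le_left _ _)
    · rw [mul_comm, ← le_div_iff₀ (by positivity)]
      exact (min_le_right _ _).trans (min_le_right _ _)
  have key : ∀ j : ℕ, ∃ (c : ℤ → ℂ) (M' : ℕ) (m : TT → ℝ), M ≤ M' ∧ Blk Λ M M' c ∧ Continuous m ∧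
      (∀ t, 0 ≤ m t) ∧ (∀ t, m t ≤ R) ∧
      (∀ t, ‖PS c M' t - g t * ((1 - m t : ℝ) : ℂ)‖ ≤ j * θ) ∧
      (∀ t N, ‖PS c N t‖ ≤ 3 * R * ‖g t‖ + (j + 1) * θ) ∧
      ∫ t, m t ∂μT ≤ 1 + j * θ ∧
      (∫ t, min (m t) (R - m t) ^ 2 ∂μT ≤ κ ∨ j * (κ / 16) ≤ ∫ t, m t ^ 2 ∂μT) := by
    intro j
    induction j with
    | zero =>
      have hz : ∀ N t, PS (0 : ℤ → ℂ) N t = 0 := by intro N t; simp [PS]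
      refine ⟨0, M, fun _ => 1, le_rfl, ?_, continuous_const, ?_, ?_, ?_, ?_, ?_, ?_⟩
      · intro k hk; exact absurd rfl hk
      · intro t; exact zero_le_one
      · intro t; exact hR1
      · intro t; simp [hz]
      · intro t N; rw [hz]; simp; positivity
      · simp
      · right; simp
    | succ j ih =>
      obtain ⟨c, M₁, m, hM₁, hB, hmc, hm0, hmR, happ, hmax, hintegr, hor⟩ := ih
      by_cases hleft : ∫ t, min (m t) (R - m t) ^ 2 ∂μT ≤ κ
      · refine ⟨c, M₁, m, hM₁, hB, hmc, hm0, hmR, ?_, ?_, ?_, Or.inl hleft⟩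
        · intro t; have := happ t; push_cast at *; linarith
        · intro t N; have := hmax t N; push_cast at *; linarith
        · push_cast; linarith
      have hright := hor.resolve_left hleft
      rw [not_le] at hleft
      obtain ⟨q, hq⟩ : ∃ q : TT → ℝ, q = fun t => min (m t) (R - m t) := ⟨_, rfl⟩
      have hqt : ∀ t, min (m t) (R - m t) = q t := by intro t; rw [hq]
      have hqc : Continuous q := by rw [hq]; fun_prop
      have hq0 : ∀ t, 0 ≤ q t := fun t => by
        rw [← hqt]; exact le_min (hm0 t) (by linarith [hmR t])
      have hqm : ∀ t, q t ≤ m t := fun t => by rw [← hqt]; exact min_le_left _ _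
      have hqR : ∀ t, q t ≤ R - m t := fun t => by rw [← hqt]; exact min_le_right _ _
      simp_rw [hqt] at hleft
      obtain ⟨d, M₂, ψ, hM₂, hBd, hψc, hψ, hd, hdN, i1, i2, i3⟩ := round hΛ
        (Q := fun t => -(g t * (q t : ℂ))) (by fun_prop) (u₁ := q) hqc
        (u₂ := fun t => m t * q t) (by fun_prop) (v := fun t => q t ^ 2) (by fun_prop)
        (fun t => sq_nonneg _) hθ0 M₁
      have hqψ : ∀ t, |q t * ψ t| ≤ q t := by
        intro t
        rw [abs_mul, abs_of_nonneg (hq0 t)]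
        exact mul_le_of_le_one_right (hq0 t) (hψ t)
      refine ⟨c + d, M₂, fun t => m t + q t * ψ t, hM₁.trans hM₂, Blk_add hB hBd hM₁ hM₂,
        by fun_prop, ?_, ?_, ?_, ?_, ?_, Or.inr ?_⟩
      · intro t
        have := (abs_le.1 (hqψ t)).1
        have := hqm t
        simp only
        linarith
      · intro t
        have := (abs_le.1 (hqψ t)).2
        have := hqR t
        simp only
        linarith
      · intro t
        rw [PS_concat_high hB hM₂]
        have e : PS c M₁ t + PS d M₂ t - g t * ((1 - (m t + q t * ψ t) : ℝ) : ℂ) =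
          (PS c M₁ t - g t * ((1 - m t : ℝ) : ℂ)) +
            (PS d M₂ t - -(g t * (q t : ℂ)) * (ψ t : ℂ)) := by push_cast; ring
        rw [e]
        refine (norm_add_le _ _).trans ?_
        have := happ t
        have := hd t
        push_cast at *
        linarith
      · intro t N
        push_cast
        rcases le_total N M₁ with hN | hN
        · rw [PS_concat_low hBd hN]
          have := hmax t N
          linarith
        · rw [PS_concat_high hB hN]
          have b1 : ‖PS c M₁ t‖ ≤ R * ‖g t‖ + j * θ := by
            have e : PS c M₁ t = (PS c M₁ t - g t * ((1 - m t : ℝ) : ℂ)) +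
              g t * ((1 - m t : ℝ) : ℂ) := by ring
            rw [e]
            refine (norm_add_le _ _).trans ?_
            have s2 : ‖g t * ((1 - m t : ℝ) : ℂ)‖ ≤ R * ‖g t‖ := by
              rw [norm_mul, Complex.norm_real, Real.norm_eq_abs, mul_comm]
              refine mul_le_mul_of_nonneg_right ?_ (norm_nonneg _)
              rw [abs_le]
              constructor <;> linarith [hm0 t, hmR t]
            have := happ t
            linarith
          have b2 : ‖PS d N t‖ ≤ 2 * (R * ‖g t‖) + θ := by
            refine (hdN t N).trans ?_
            have : ‖-(g t * (q t : ℂ))‖ ≤ R * ‖g t‖ := by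
              rw [norm_neg, norm_mul, Complex.norm_real, Real.norm_eq_abs, abs_of_nonneg (hq0 t),
                mul_comm]
              exact mul_le_mul_of_nonneg_right ((hqm t).trans (hmR t)) (norm_nonneg _)
            linarith
          have := norm_add_le (PS c M₁ t) (PS d N t)
          linarith
      · rw [integral_add (int_cont hmc) (int_cont (by fun_prop))]
        have := (abs_le.1 i1).2
        push_cast
        linarith
      · have e : ∫ t, (m t + q t * ψ t) ^ 2 ∂μT = (∫ t, m t ^ 2 ∂μT +
            ∫ t, 2 * (m t * q t * ψ t) ∂μT) + ∫ t, q t ^ 2 * ψ t ^ 2 ∂μT := by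
          rw [← integral_add (int_cont (by fun_prop)) (int_cont (by fun_prop)),
            ← integral_add (int_cont (by fun_prop)) (int_cont (by fun_prop))]
          congr 1; ext t; ring
        rw [integral_const_mul] at e
        rw [e]
        have := (abs_le.1 i2).1
        push_cast
        linarith
  obtain ⟨c, M', m, hM, hB, hmc, hm0, hmR, happ, hmax, hintegr, hor⟩ := key J
  refine ⟨c, M', hM, hB, ?_, ?_⟩
  · have hleft : ∫ t, min (m t) (R - m t) ^ 2 ∂μT ≤ κ := by
      refine hor.resolve_right fun h => ?_
      have : ∫ t, m t ^ 2 ∂μT ≤ ∫ _t, R ^ 2 ∂μT :=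
        integral_mono (int_cont (by fun_prop)) (int_cont (by fun_prop))
          fun t => pow_le_pow_left₀ (hm0 t) (hmR t) 2
      simp at this
      linarith
    have hsub : {t | η < ‖PS c M' t - g t‖} ⊆
        {t | s ^ 2 ≤ min (m t) (R - m t) ^ 2} ∪ {t | R / 2 ≤ m t} := by
      intro t ht
      simp only [Set.mem_ofPred_eq, Set.mem_union] at *
      by_contra hcon
      rw [not_or, not_le, not_le] at hcon
      obtain ⟨h1, h2⟩ := hcon
      have h3 : min (m t) (R - m t) < s := by
        by_contra h4
        rw [not_lt] at h4
        have := pow_le_pow_left₀ hs0.le h4 2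
        linarith
      have h5 : m t < s := by
        rcases min_lt_iff.1 h3 with h | h
        · exact h
        · linarith
      have e : PS c M' t - g t = (PS c M' t - g t * ((1 - m t : ℝ) : ℂ)) - g t * (m t : ℂ) := by
        push_cast; ring
      rw [e] at ht
      have h6 := norm_sub_le (PS c M' t - g t * ((1 - m t : ℝ) : ℂ)) (g t * (m t : ℂ))
      rw [norm_mul, Complex.norm_real, Real.norm_eq_abs, abs_of_nonneg (hm0 t)] at h6
      have h7 : ‖g t‖ * m t ≤ s * K := by
        rw [mul_comm]
        exact mul_le_mul h5.le (hK t) (norm_nonneg _) hs0.le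
      have := happ t
      linarith
    have k1 := mul_meas_ge_le_integral_of_nonneg (μ := μT)
      (f := fun t => min (m t) (R - m t) ^ 2) (Eventually.of_forall fun t => sq_nonneg _)
      (int_cont (by fun_prop)) (s ^ 2)
    have k2 := mul_meas_ge_le_integral_of_nonneg (μ := μT)
      (f := m) (Eventually.of_forall hm0) (int_cont hmc) (R / 2)
    have k1' : μT.real {t | s ^ 2 ≤ min (m t) (R - m t) ^ 2} ≤ ε / 2 := by
      rw [hκ] at hleft
      exact le_of_mul_le_mul_left (k1.trans hleft) (by positivity)
    have k2' : μT.real {t | R / 2 ≤ m t} ≤ ε / 2 := by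
      refine le_of_mul_le_mul_left (k2.trans ?_) (show 0 < R / 2 by positivity)
      linarith
    refine (measureReal_mono hsub).trans ((measureReal_union_le _ _).trans ?_)
    linarith
  · intro t N
    have := hmax t N
    linarith

end ArMen

namespace ArMen

lemma approx {r : TT → ℂ} (hr : Measurable r) {ε η : ℝ} (hε : 0 < ε) (hη : 0 < η) :
    ∃ g : TT → ℂ, Continuous g ∧ μT.real {t | η < ‖r t - g t‖} ≤ ε := by
  have hS : ∀ n : ℕ, MeasurableSet {t | (n : ℝ) < ‖r t‖} := fun n =>
    measurableSet_lt measurable_const hr.norm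
  have hT : Tendsto (fun n : ℕ => μT {t | (n : ℝ) < ‖r t‖}) atTop (𝓝 0) := by
    have h0 : (⋂ n : ℕ, {t | (n : ℝ) < ‖r t‖}) = ∅ := by
      ext t
      simp only [Set.mem_iInter, Set.mem_empty_iff_false, iff_false, not_forall]
      obtain ⟨n, hn⟩ := exists_nat_gt ‖r t‖
      exact ⟨n, fun h => lt_asymm hn h⟩
    have := tendsto_measure_iInter_atTop (μ := μT) (s := fun n : ℕ => {t | (n : ℝ) < ‖r t‖})
      (fun n => (hS n).nullMeasurableSet)
      (fun a b hab t ht => lt_of_le_of_lt (show (a : ℝ) ≤ (b : ℝ) from by exact_mod_cast hab) (show (b : ℝ) < ‖r t‖ from ht)) ⟨0, measure_ne_top _ _⟩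
    rwa [h0, measure_empty] at this
  obtain ⟨n, hn⟩ := (hT.eventually (ge_mem_nhds
    (show (0 : ENNReal) < ENNReal.ofReal (ε / 2) by simpa using hε))).exists
  have hn' : μT.real {t | (n : ℝ) < ‖r t‖} ≤ ε / 2 :=
    ENNReal.toReal_le_of_le_ofReal (by positivity) hn
  obtain ⟨r', hr'⟩ : ∃ r' : TT → ℂ, r' = {t | (n : ℝ) < ‖r t‖}ᶜ.indicator r := ⟨_, rfl⟩
  have hintegr : Integrable r' μT := by
    refine Integrable.of_bound (C := n) ?_ (Eventually.of_forall fun t => ?_)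
    · rw [hr']; exact (hr.indicator (hS n).compl).aestronglyMeasurable
    · rw [hr', Set.indicator_apply]
      split_ifs with h
      · exact not_lt.1 h
      · simp
  obtain ⟨g, hg, hgi⟩ := hintegr.exists_boundedContinuous_integral_sub_le
    (show 0 < η * (ε / 2) by positivity)
  refine ⟨g, g.continuous, ?_⟩
  have hsub : {t | η < ‖r t - g t‖} ⊆ {t | (n : ℝ) < ‖r t‖} ∪ {t | η ≤ ‖r' t - g t‖} := by
    intro t ht
    by_cases h : (n : ℝ) < ‖r t‖
    · exact Or.inl h
    · refine Or.inr ?_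
      have : r' t = r t := by
        rw [hr']; exact Set.indicator_of_mem h r
      change η ≤ ‖r' t - g t‖
      rw [this]
      exact le_of_lt ht
  have k1 := mul_meas_ge_le_integral_of_nonneg (μ := μT) (f := fun t => ‖r' t - g t‖)
    (Eventually.of_forall fun t => norm_nonneg _) (hintegr.sub hgi).norm η
  have k2 := le_of_mul_le_mul_left (k1.trans hg) hη
  refine (measureReal_mono hsub).trans ((measureReal_union_le _ _).trans ?_)
  linarith

lemma step {Λ : Set ℤ} {A ε : ℝ} (hA : 0 < A) (hε : 0 < ε)
    (hmain : ∀ g : TT → ℂ, Continuous g → ∀ η : ℝ, 0 < η → ∀ M : ℕ,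
      ∃ (c : ℤ → ℂ) (M' : ℕ), M ≤ M' ∧ Blk Λ M M' c ∧
      μT.real {t | η < ‖PS c M' t - g t‖} ≤ ε ∧ ∀ t N, ‖PS c N t‖ ≤ A * ‖g t‖ + η)
    {r : TT → ℂ} (hr : Measurable r) {δ : ℝ} (hδ : 0 < δ) (M : ℕ) :
    ∃ (c : ℤ → ℂ) (M' : ℕ), M < M' ∧ Blk Λ M M' c ∧
      μT.real {t | ¬ (‖r t - PS c M' t‖ ≤ δ ∧ ∀ N, ‖PS c N t‖ ≤ A * ‖r t‖ + δ)} ≤ 2 * ε := by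
  obtain ⟨η, hη0, hηδ, hηA⟩ : ∃ η : ℝ, 0 < η ∧ η ≤ δ / 2 ∧ A * η ≤ δ / 2 := by
    refine ⟨min (δ / 2) (δ / 2 / A), lt_min (by positivity) (by positivity), min_le_left _ _, ?_⟩
    rw [mul_comm, ← le_div_iff₀ hA]; exact min_le_right _ _
  obtain ⟨g, hg, hrg⟩ := approx hr hε hη0
  obtain ⟨c, M', hM, hB, h1, h2⟩ := hmain g hg η hη0 M
  refine ⟨c, M' + 1, by omega, ?_, ?_⟩
  · intro k hk
    obtain ⟨a, b, e⟩ := hB k hk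
    exact ⟨a, b, by push_cast; omega⟩
  · have hsub : {t | ¬ (‖r t - PS c (M' + 1) t‖ ≤ δ ∧ ∀ N, ‖PS c N t‖ ≤ A * ‖r t‖ + δ)} ⊆
        {t | η < ‖r t - g t‖} ∪ {t | η < ‖PS c M' t - g t‖} := by
      intro t ht
      by_contra hcon
      rw [Set.mem_union, not_or] at hcon
      have a1 : ‖r t - g t‖ ≤ η := not_lt.1 hcon.1
      have a2 : ‖PS c M' t - g t‖ ≤ η := not_lt.1 hcon.2
      refine ht ⟨?_, fun N => ?_⟩
      · rw [PS_high hB (Nat.le_succ M')]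
        have := norm_sub_le (r t - g t) (PS c M' t - g t)
        rw [sub_sub_sub_cancel_right] at this
        linarith
      · have b1 := h2 t N
        have b2 : ‖g t‖ ≤ ‖r t‖ + η := by
          have := norm_sub_norm_le (g t) (r t)
          rw [norm_sub_rev] at this
          linarith
        have b3 := mul_le_mul_of_nonneg_left b2 hA.le
        linarith
    refine (measureReal_mono hsub).trans ((measureReal_union_le _ _).trans ?_)
    linarith

lemma assemble {Λ : Set ℤ} (hΛ : Good Λ) {f : TT → ℂ} (hf : Measurable f) :
    ∃ c : ℤ → ℂ, (∀ k, c k ≠ 0 → k ∈ Λ) ∧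
      ∀ᵐ t ∂μT, Tendsto (fun N => PS c N t) atTop (𝓝 (f t)) := by
  have hpow : ∀ n : ℕ, (0 : ℝ) < (1 / 2) ^ n := fun n => by positivity
  choose A hA hmain using fun n : ℕ => main_lemma hΛ (hpow n)
  obtain ⟨δ, hδ0, hδ1, hδA⟩ : ∃ δ : ℕ → ℝ, (∀ n, 0 < δ n) ∧ (∀ n, δ n ≤ (1 / 2) ^ n) ∧
      ∀ n, A n * δ n ≤ (1 / 2) ^ n := by
    refine ⟨fun n => min ((1 / 2) ^ n) ((1 / 2) ^ n / A n), fun n => ?_, fun n => min_le_left _ _,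
      fun n => ?_⟩
    · exact lt_min (hpow n) (div_pos (hpow n) (hA n))
    · rw [mul_comm, ← le_div_iff₀ (hA n)]; exact min_le_right _ _
  choose d M' hM' hB' hbad' using fun (n : ℕ) (S : (ℤ → ℂ) × ℕ) =>
    step (hA n) (hpow n) (hmain n) (r := fun t => f t - PS S.1 S.2 t)
      (hf.sub (PS_cont S.1 S.2).measurable) (hδ0 (n + 1)) S.2
  obtain ⟨S, hS0, hS⟩ : ∃ S : ℕ → (ℤ → ℂ) × ℕ, S 0 = (0, 0) ∧
      ∀ n, S (n + 1) = ((S n).1 + d n (S n), M' n (S n)) :=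
    ⟨fun n => Nat.rec (0, 0) (fun n s => (s.1 + d n s, M' n s)) n, rfl, fun n => rfl⟩
  obtain ⟨C, hC⟩ : ∃ C : ℕ → ℤ → ℂ, C = fun n => (S n).1 := ⟨_, rfl⟩
  obtain ⟨Mn, hMn⟩ : ∃ Mn : ℕ → ℕ, Mn = fun n => (S n).2 := ⟨_, rfl⟩
  obtain ⟨D, hD⟩ : ∃ D : ℕ → ℤ → ℂ, D = fun n => d n (S n) := ⟨_, rfl⟩
  have hC0 : C 0 = 0 := by simp [hC, hS0]
  have hM0 : Mn 0 = 0 := by simp [hMn, hS0]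
  have hCs : ∀ n, C (n + 1) = C n + D n := by intro n; simp only [hC, hD, hS]
  have hMs : ∀ n, Mn n < Mn (n + 1) := by
    intro n; simp only [hMn, hS]; exact hM' n (S n)
  have hDB : ∀ n, Blk Λ (Mn n) (Mn (n + 1)) (D n) := by
    intro n; simp only [hMn, hS, hD]; exact hB' n (S n)
  have hbad : ∀ n, μT.real {t | ¬ (‖(f t - PS (C n) (Mn n) t) - PS (D n) (Mn (n + 1)) t‖ ≤ δ (n + 1)
      ∧ ∀ N, ‖PS (D n) N t‖ ≤ A n * ‖f t - PS (C n) (Mn n) t‖ + δ (n + 1))}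
        ≤ 2 * (1 / 2) ^ n := by
    intro n
    simp only [hMn, hS, hD, hC]
    exact hbad' n (S n)
  clear hbad' hB' hM' hmain
  have hmono : StrictMono Mn := strictMono_nat_of_lt_succ hMs
  have hCB : ∀ n, Blk Λ 0 (Mn n) (C n) := by
    intro n
    induction n with
    | zero => intro k hk; rw [hC0] at hk; exact absurd rfl hk
    | succ n ih => rw [hCs]; exact Blk_add ih (hDB n) (Nat.zero_le _) (hMs n).le
  have hstab : ∀ n (k : ℤ), |k| ≤ Mn n → ∀ p, C (n + p) k = C n k := by
    intro n k hk p
    induction p with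
    | zero => rfl
    | succ p ih =>
      rw [← add_assoc, hCs, Pi.add_apply, ih]
      have : D (n + p) k = 0 := by
        by_contra hne
        have h1 := (hDB _ k hne).2.1
        have h2 := hmono.monotone (show n ≤ n + p by omega)
        omega
      rw [this, add_zero]
  obtain ⟨c, hc⟩ : ∃ c : ℤ → ℂ, c = fun k => C k.natAbs k := ⟨_, rfl⟩
  have hcC : ∀ n (k : ℤ), |k| ≤ Mn n → C n k = c k := by
    intro n k hk
    have h1 : |k| ≤ Mn k.natAbs := by
      have := hmono.le_apply (x := k.natAbs)
      rw [Int.abs_eq_natAbs]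
      exact_mod_cast this
    rw [hc]
    simp only
    rw [← hstab n k hk k.natAbs, ← hstab k.natAbs k h1 n, add_comm]
  have hPS : ∀ n N t, N ≤ Mn n → PS c N t = PS (C n) N t := by
    intro n N t hN
    refine Finset.sum_congr rfl fun k hk => ?_
    rw [Finset.mem_Icc] at hk
    rw [hcC n k ((abs_le.2 hk).trans (by exact_mod_cast hN))]
  refine ⟨c, ?_, ?_⟩
  · intro k hk
    rw [hc] at hk
    exact (hCB _ k hk).1
  · have hBC := ae_eventually_notMem (μ := μT)
      (s := fun n => {t | ¬ (‖(f t - PS (C n) (Mn n) t) - PS (D n) (Mn (n + 1)) t‖ ≤ δ (n + 1)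
      ∧ ∀ N, ‖PS (D n) N t‖ ≤ A n * ‖f t - PS (C n) (Mn n) t‖ + δ (n + 1))}) (by
        have hsum : Summable fun n : ℕ => (2 : ℝ) * (1 / 2) ^ n :=
          summable_geometric_two.mul_left 2
        refine ne_top_of_le_ne_top hsum.tsum_ofReal_ne_top (ENNReal.tsum_le_tsum fun n => ?_)
        rw [← ofReal_measureReal (measure_ne_top _ _)]
        exact ENNReal.ofReal_le_ofReal (hbad n))
    filter_upwards [hBC] with t ht
    obtain ⟨n₀, hn₀⟩ := eventually_atTop.1 ht
    have hgood : ∀ n ≥ n₀, ‖(f t - PS (C n) (Mn n) t) - PS (D n) (Mn (n + 1)) t‖ ≤ δ (n + 1)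
      ∧ ∀ N, ‖PS (D n) N t‖ ≤ A n * ‖f t - PS (C n) (Mn n) t‖ + δ (n + 1) :=
      fun n hn => not_not.1 (hn₀ n hn)
    have hr : ∀ n ≥ n₀ + 1, ‖f t - PS (C n) (Mn n) t‖ ≤ δ n := by
      intro n hn
      obtain ⟨p, rfl⟩ : ∃ p, n = p + 1 := ⟨n - 1, by omega⟩
      have := (hgood p (by omega)).1
      rw [hCs, PS_concat_high (hCB p) (hMs p).le]
      rwa [sub_sub] at this
    have hfin : ∀ n ≥ n₀ + 1, ∀ N, Mn n ≤ N → N ≤ Mn (n + 1) →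
        ‖f t - PS c N t‖ ≤ 3 * (1 / 2) ^ n := by
      intro n hn N h1 h2
      rw [hPS (n + 1) N t h2, hCs, PS_concat_high (hCB n) h1, ← sub_sub]
      have a1 := norm_sub_le (f t - PS (C n) (Mn n) t) (PS (D n) N t)
      have a2 := (hgood n (by omega)).2 N
      have a3 := hr n hn
      have a4 := mul_le_mul_of_nonneg_left a3 (hA n).le
      have a5 := hδA n
      have a6 := hδ1 n
      have a7 := hδ1 (n + 1)
      rw [pow_succ] at a7
      have := hpow n
      linarith
    rw [Metric.tendsto_atTop]
    intro e he
    obtain ⟨p, hp⟩ : ∃ p : ℕ, (1 / 2 : ℝ) ^ p < e / 3 :=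
      exists_pow_lt_of_lt_one (by positivity) (by norm_num)
    refine ⟨Mn (n₀ + 1 + p), fun N hN => ?_⟩
    have hex : ∃ j, N < Mn j := ⟨N + 1, lt_of_lt_of_le (Nat.lt_succ_self N) hmono.le_apply⟩
    have hj := Nat.find_spec hex
    have hj1 : n₀ + 1 + p < Nat.find hex := hmono.lt_iff_lt.1 (lt_of_le_of_lt hN hj)
    obtain ⟨n, hn⟩ : ∃ n, Nat.find hex = n + 1 := ⟨Nat.find hex - 1, by omega⟩
    have hlo : Mn n ≤ N := not_lt.1 (Nat.find_min hex (by omega))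
    rw [hn] at hj
    have := hfin n (by omega) N hlo hj.le
    rw [dist_comm, dist_eq_norm]
    have h3 : (1 / 2 : ℝ) ^ n ≤ (1 / 2) ^ p :=
      pow_le_pow_of_le_one (by norm_num) (by norm_num) (by omega)
    linarith

end ArMen

/-- **Arutyunyan's theorem**: a set `Λ ⊆ ℤ` which is symmetric with respect to zero and
contains arbitrarily long segments of consecutive integers is a Menshov spectrum. -/
theorem arutyunyan_menshov_spectrum (Λ : Set ℤ)
    (hsymm : ∀ k : ℤ, k ∈ Λ ↔ -k ∈ Λ)
    (hseg : ∀ L : ℕ, ∃ a : ℤ, ∀ i : ℕ, i ≤ L → a + (i : ℤ) ∈ Λ) :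
    IsMenshovSpectrum Λ := by
  intro f hf
  obtain ⟨c, hc, h⟩ := ArMen.assemble (ArMen.good_of hsymm hseg) hf
  refine ⟨c, ?_⟩
  rw [AddCircle.volume_eq_smul_haarAddCircle]
  refine Measure.ae_smul_measure ?_ _
  filter_upwards [h] with t ht
  have hind : Λ.indicator c = c := by
    rw [Set.indicator_eq_self]
    exact fun k hk => hc k hk
  have : (fun N => menshovPartialSum Λ c N t) = fun N => ArMen.PS c N t := by
    funext N
    rw [menshovPartialSum, hind, ArMen.PS]
  rw [this]
  exact ht
end

section
/- The set ℤ⁺ of positive integers is not a Menshov spectrum: there exists a measurable function f : 𝕋 → ℂ such that there are no complex coefficients (c_k)_{k>0} for which the partial sums S_N(t) = ∑_{0<k≤N} c_k e^{ikt} converge to f(t) for almost every t ∈ 𝕋. In fact, any f ∈ L⁰(𝕋) which vanishes on a set of positive measure but is not almost everywhere zero admits no such representation. -/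
open MeasureTheory Filter Topology Real

/-- The partial sum `S_N(t) = ∑_{0 < k ≤ N} c_k e^{ikt}` of a series with positive
spectrum on the circle `𝕋 = ℝ/2πℤ`. -/
noncomputable def analyticPartialSum (c : ℕ → ℂ) (N : ℕ) (t : AddCircle (2 * π)) : ℂ :=
  ∑ k ∈ Finset.Icc 1 N, c k * fourier (k : ℤ) t

namespace MenshovAux

abbrev TT := AddCircle (2 * π)

/-- The point `e^{it}` of the unit circle. -/
noncomputable def ee (t : TT) : ℂ := fourier 1 t

lemma ee_coe (x : ℝ) : ee (x : TT) = Complex.exp (Complex.I * x) := by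
  unfold ee
  rw [fourier_coe_apply]
  congr 1
  have : (π : ℂ) ≠ 0 := by exact_mod_cast Real.pi_ne_zero
  push_cast
  field_simp

lemma norm_ee (t : TT) : ‖ee t‖ = 1 := by
  unfold ee; rw [fourier_apply]; exact Circle.norm_coe _

lemma ee_ne (t : TT) : ee t ≠ 0 := by
  intro h; have := norm_ee t; rw [h] at this; simp at this

lemma continuous_ee : Continuous ee := (fourier 1).continuous

lemma fourier_eq (k : ℕ) (t : TT) : (fourier (k : ℤ) t : ℂ) = ee t ^ k := by
  induction k with
  | zero => simp
  | succ n ih => push_cast; rw [fourier_add, ih, pow_succ]; rfl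

lemma ee_sub (s t : TT) : ee (s - t) * ee t = ee s := by
  unfold ee
  simp only [fourier_apply, one_zsmul]
  rw [← Circle.coe_mul, ← AddCircle.toCircle_add, sub_add_cancel]

lemma ee_injective : Function.Injective ee := by
  intro s t h
  unfold ee at h
  rw [fourier_one, fourier_one] at h
  exact AddCircle.injective_toCircle (by positivity) (Circle.ext h)

lemma ee_dist (s t : TT) : ‖ee s - ee t‖ ≤ ‖s - t‖ := by
  have h1 : ee s - ee t = (ee (s - t) - 1) * ee t := by rw [sub_mul, ee_sub, one_mul]
  rw [h1, norm_mul, norm_ee, mul_one]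
  generalize s - t = u
  induction u using QuotientAddGroup.induction_on with
  | H x =>
    have h2 : ((x - round ((2 * π)⁻¹ * x) * (2 * π) : ℝ) : TT) = (x : TT) := by
      have := AddCircle.coe_sub (p := 2 * π) x (round ((2 * π)⁻¹ * x) * (2 * π))
      rw [this]
      have h3 : ((round ((2 * π)⁻¹ * x) * (2 * π) : ℝ) : TT) = 0 := by
        rw [AddCircle.coe_eq_zero_iff]
        exact ⟨round ((2 * π)⁻¹ * x), by simp⟩
      rw [h3, sub_zero]
    have h4 := AddCircle.norm_eq (p := 2 * π) (x := x)
    change ‖ee (x : TT) - 1‖ ≤ ‖(x : TT)‖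
    rw [h4, ← h2, ee_coe]
    exact Real.norm_exp_I_mul_ofReal_sub_one_le

lemma ee_surj (z : ℂ) : ∃ t : TT, z = ‖z‖ * ee t := by
  refine ⟨((Complex.arg z : ℝ) : TT), ?_⟩
  rw [ee_coe, mul_comm Complex.I, Complex.norm_mul_exp_arg_mul_I]

/-- Poisson kernel -/
noncomputable def ker (z : ℂ) (t : TT) : ℝ := (1 - ‖z‖ ^ 2) / ‖ee t - z‖ ^ 2

lemma sub_norm_pos {z : ℂ} (t : TT) : 1 - ‖z‖ ≤ ‖ee t - z‖ := by
  have := norm_sub_norm_le (ee t) z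
  rwa [norm_ee] at this

lemma ee_sub_ne {z : ℂ} (hz : ‖z‖ < 1) (t : TT) : ee t - z ≠ 0 := by
  have := sub_norm_pos (z := z) t
  intro h; rw [h] at this; simp at this; linarith

lemma ker_eq (z : ℂ) (t : TT) : ((ee t + z) / (ee t - z)).re = ker z t := by
  have := congrFun (poissonKernel_eq_re_herglotzRieszKernel (c := 0) (w := z)) (ee t)
  simp [poissonKernel, herglotzRieszKernel, norm_ee] at this
  rw [ker, this]

lemma ker_nonneg {z : ℂ} (hz : ‖z‖ < 1) (t : TT) : 0 ≤ ker z t := by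
  unfold ker
  have : ‖z‖ ^ 2 ≤ 1 := by nlinarith [norm_nonneg z]
  exact div_nonneg (by linarith) (by positivity)

lemma continuous_hk {z : ℂ} (hz : ‖z‖ < 1) : Continuous fun t => (ee t + z) / (ee t - z) :=
  (continuous_ee.add continuous_const).div (continuous_ee.sub continuous_const) (ee_sub_ne hz)

lemma integrable_hk {z : ℂ} (hz : ‖z‖ < 1) (S : Set TT) :
    Integrable (fun t => (ee t + z) / (ee t - z)) (volume.restrict S) :=
  ((continuous_hk hz).integrable_of_hasCompactSupport (HasCompactSupport.of_compactSpace _)).restrict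

lemma integrable_ker {z : ℂ} (hz : ‖z‖ < 1) (S : Set TT) :
    Integrable (ker z) (volume.restrict S) := by
  have := (integrable_hk hz S).re
  refine this.congr (Eventually.of_forall fun t => ?_)
  exact ker_eq z t

/-- Herglotz transform of a set -/
noncomputable def HZ (S : Set TT) (z : ℂ) : ℂ := ∫ t in S, (ee t + z) / (ee t - z)

lemma HZ_re (S : Set TT) {z : ℂ} (hz : ‖z‖ < 1) : (HZ S z).re = ∫ t in S, ker z t := by
  unfold HZ
  have := integral_re (integrable_hk hz S)
  simp only [RCLike.re_to_complex, ker_eq] at this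
  rw [this]

lemma HZ_zero (S : Set TT) : (HZ S 0).re = volume.real S := by
  rw [HZ_re S (by simp)]
  simp [ker, norm_ee]

lemma HZ_diff (S : Set TT) : DifferentiableOn ℂ (HZ S) (Metric.ball 0 1) := by
  intro z hz
  have hz1 : ‖z‖ < 1 := by simpa using hz
  set d : ℝ := (1 - ‖z‖) / 2 with hd
  have hd0 : 0 < d := by rw [hd]; linarith
  have hb : ∀ x ∈ Metric.ball z d, ‖x‖ < 1 - d := by
    intro x hx
    have h1 : ‖x - z‖ < d := by simpa [dist_eq_norm] using hx
    have h2 : ‖x‖ ≤ ‖z‖ + ‖x - z‖ := by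
      have := norm_add_le z (x - z); simpa using this
    rw [hd] at *; linarith
  have key := hasDerivAt_integral_of_dominated_loc_of_deriv_le (𝕜 := ℂ) (μ := volume.restrict S)
    (F := fun z t => (ee t + z) / (ee t - z)) (F' := fun z t => 2 * ee t / (ee t - z) ^ 2)
    (x₀ := z) (s := Metric.ball z d) (bound := fun _ => 2 / d ^ 2)
    (Metric.ball_mem_nhds z hd0) ?_ (integrable_hk hz1 S) ?_ ?_ (integrable_const _) ?_
  · exact key.2.differentiableAt.differentiableWithinAt
  · filter_upwards [Metric.ball_mem_nhds z hd0] with x hx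
    exact (continuous_hk (by linarith [hb x hx])).aestronglyMeasurable
  · refine Continuous.aestronglyMeasurable ?_
    exact (continuous_const.mul continuous_ee).div ((continuous_ee.sub continuous_const).pow 2)
      fun t => pow_ne_zero _ (ee_sub_ne hz1 t)
  · refine Eventually.of_forall fun t x hx => ?_
    have h1 := sub_norm_pos (z := x) t
    have h2 := hb x hx
    rw [norm_div, norm_mul, norm_ee, norm_pow]
    have : d ≤ ‖ee t - x‖ := by linarith
    simp only [Complex.norm_ofNat, mul_one]
    gcongr
  · refine Eventually.of_forall fun t x hx => ?_
    have hne := ee_sub_ne (z := x) (by linarith [hb x hx]) t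
    have := ((hasDerivAt_id' x).const_add (ee t)).div ((hasDerivAt_id' x).const_sub (ee t)) hne
    refine HasDerivAt.congr_deriv this ?_
    congr 1
    ring

lemma ker_total {z : ℂ} (hz : ‖z‖ < 1) : ∫ t, ker z t = 2 * π := by
  have h := DiffContOnCl.circleAverage_poissonKernel_smul (E := ℂ) (f := fun _ => 1) (c := 0) (R := 1)
    (w := z) diffContOnCl_const (by simpa using hz)
  rw [Real.circleAverage_def] at h
  have h2 : ∀ θ : ℝ, (poissonKernel 0 z • fun _ => (1 : ℂ)) (circleMap 0 1 θ)
      = ((ker z (θ : TT) : ℝ) : ℂ) := by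
    intro θ
    have : circleMap 0 1 θ = ee (θ : TT) := by
      rw [ee_coe, circleMap]; simp [mul_comm]
    rw [this]
    simp [poissonKernel, ker, norm_ee]
  simp only [h2] at h
  rw [intervalIntegral.integral_ofReal] at h
  have h3 := AddCircle.intervalIntegral_preimage (2 * π) 0 (ker z)
  rw [zero_add] at h3
  rw [h3] at h
  have hp : (0 : ℝ) < 2 * π := by positivity
  have h4 : (2 * π)⁻¹ * ∫ t, ker z t = 1 := by
    rw [Complex.real_smul] at h
    exact_mod_cast h
  field_simp at h4
  linarith

lemma ker_le_total {z : ℂ} (hz : ‖z‖ < 1) (S : Set TT) : ∫ t in S, ker z t ≤ 2 * π := by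
  refine le_trans ?_ (ker_total hz).le
  have := integrable_ker hz Set.univ
  rw [Measure.restrict_univ] at this
  exact setIntegral_le_integral this (Eventually.of_forall fun t => ker_nonneg hz t)

lemma exists_near {z : ℂ} (hz : ‖z‖ < 1) (B : Set TT)
    (h : ∫ t in B, ker z t < 1 / 2) : ∃ t ∉ B, ‖ee t - z‖ ≤ 2 * (1 - ‖z‖) := by
  by_contra! hcon
  obtain ⟨t0, ht0⟩ := ee_surj z
  set ρ := ‖z‖ with hρ
  have hρ0 : 0 ≤ ρ := norm_nonneg z
  have hnear : ∀ t ∈ Metric.closedBall t0 (1 - ρ), ‖ee t - z‖ ≤ 2 * (1 - ρ) := by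
    intro t ht
    have h1 : ‖ee t - ee t0‖ ≤ 1 - ρ := by
      refine (ee_dist t t0).trans ?_
      simpa [dist_eq_norm] using ht
    have h2 : ‖ee t0 - z‖ = 1 - ρ := by
      have : ee t0 - z = ((1 - ρ : ℝ) : ℂ) * ee t0 := by
        conv_lhs => rw [ht0]
        push_cast; ring
      rw [this, norm_mul, norm_ee, mul_one, Complex.norm_real, Real.norm_eq_abs, abs_of_pos]
      linarith
    calc ‖ee t - z‖ = ‖(ee t - ee t0) + (ee t0 - z)‖ := by ring_nf
      _ ≤ _ := norm_add_le _ _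
      _ ≤ _ := by linarith
  have hsub : Metric.closedBall t0 (1 - ρ) ⊆ B := by
    intro t ht
    by_contra hB
    exact absurd (hnear t ht) (not_le.mpr (hcon t hB))
  have h1 : ∫ t in Metric.closedBall t0 (1 - ρ), ker z t ≤ ∫ t in B, ker z t :=
    setIntegral_mono_set (integrable_ker hz B)
      (Eventually.of_forall fun t => ker_nonneg hz t) (LE.le.eventuallyLE hsub)
  have hvol : volume.real (Metric.closedBall t0 (1 - ρ)) = 2 * (1 - ρ) := by
    rw [Measure.real, AddCircle.volume_closedBall, min_eq_right, ENNReal.toReal_ofReal]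
    · linarith
    · have := Real.pi_gt_three; linarith
  have h2 : 1 / (4 * (1 - ρ)) * volume.real (Metric.closedBall t0 (1 - ρ)) ≤
      ∫ t in Metric.closedBall t0 (1 - ρ), ker z t := by
    have := setIntegral_mono_on (μ := volume) (s := Metric.closedBall t0 (1 - ρ))
      (f := fun _ => 1 / (4 * (1 - ρ))) (g := ker z) (integrable_const _) (integrable_ker hz _)
      Metric.isClosed_closedBall.measurableSet ?_
    · rw [setIntegral_const, smul_eq_mul, mul_comm] at this
      exact this
    · intro t ht
      have h3 := hnear t ht
      have h4 := sub_norm_pos (z := z) t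
      have h5 : 0 < ‖ee t - z‖ := by linarith
      unfold ker
      rw [← hρ, div_le_div_iff₀ (by linarith) (by positivity)]
      have h6 : ‖ee t - z‖ ^ 2 ≤ (2 * (1 - ρ)) ^ 2 := by gcongr
      nlinarith [mul_nonneg hρ0 (sq_nonneg (1 - ρ))]
  rw [hvol] at h2
  have h3 : 1 / (4 * (1 - ρ)) * (2 * (1 - ρ)) = 1 / 2 := by
    have : 1 - ρ ≠ 0 := by linarith
    field_simp; norm_num
  linarith

end MenshovAux

namespace MenshovAux

/-- partial sums of a power series on the circle -/
noncomputable def ss (a : ℕ → ℂ) (N : ℕ) (t : TT) : ℂ := ∑ k ∈ Finset.range N, a k * ee t ^ k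

lemma continuous_ss (a : ℕ → ℂ) (N : ℕ) : Continuous (ss a N) := by
  unfold ss
  exact continuous_finsetSum _ fun k _ => continuous_const.mul (continuous_ee.pow k)

lemma coeff_bound {a : ℕ → ℂ} {t : TT} {M : ℝ} (hM : ∀ N, ‖ss a N t‖ ≤ M) (k : ℕ) :
    ‖a k‖ ≤ 2 * M := by
  have h : a k * ee t ^ k = ss a (k + 1) t - ss a k t := by
    unfold ss; rw [Finset.sum_range_succ]; ring
  have h2 : ‖a k‖ = ‖a k * ee t ^ k‖ := by simp [norm_ee]
  rw [h2, h]
  have := norm_sub_le (ss a (k + 1) t) (ss a k t)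
  linarith [hM (k + 1), hM k]

lemma summable_pow {a : ℕ → ℂ} {C : ℝ} (ha : ∀ k, ‖a k‖ ≤ C) {z : ℂ} (hz : ‖z‖ < 1) :
    Summable fun k => a k * z ^ k := by
  refine Summable.of_norm_bounded (g := fun k => C * ‖z‖ ^ k)
    ((summable_geometric_of_lt_one (norm_nonneg z) hz).mul_left C) fun k => ?_
  rw [norm_mul, norm_pow]
  gcongr
  exact ha k

lemma diff_pow {a : ℕ → ℂ} {C : ℝ} (ha : ∀ k, ‖a k‖ ≤ C) {r : ℝ} (hr0 : 0 ≤ r) (hr : r < 1) :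
    DifferentiableOn ℂ (fun z => ∑' k, a k * z ^ k) (Metric.ball 0 r) := by
  refine Complex.differentiableOn_tsum_of_summable_norm (u := fun k => C * r ^ k)
    ((summable_geometric_of_lt_one hr0 hr).mul_left C) (fun k => ?_) Metric.isOpen_ball ?_
  · fun_prop
  · intro k w hw
    have hw' : ‖w‖ < r := by simpa using hw
    rw [norm_mul, norm_pow]
    have hC : 0 ≤ C := (norm_nonneg _).trans (ha k)
    gcongr
    exact ha k

lemma abel_parts (b : ℕ → ℂ) (w : ℂ) (n : ℕ) :
    ∑ k ∈ Finset.range n, b k * w ^ k =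
      (1 - w) * ∑ k ∈ Finset.range n, (∑ j ∈ Finset.range (k + 1), b j) * w ^ k
        + (∑ j ∈ Finset.range n, b j) * w ^ n := by
  induction n with
  | zero => simp
  | succ n ih =>
    rw [Finset.sum_range_succ, ih, Finset.sum_range_succ (fun k => (∑ j ∈ Finset.range (k + 1), b j) * w ^ k),
      Finset.sum_range_succ b n]
    ring

lemma abel_bound {a : ℕ → ℂ} {t : TT} {M η : ℝ} {n0 : ℕ} (hη : 0 ≤ η)
    (hM : ∀ N, ‖ss a N t‖ ≤ M) (h0 : ∀ N ≥ n0, ‖ss a N t‖ ≤ η)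
    {z : ℂ} (hz : ‖z‖ < 1) (hzt : ‖ee t - z‖ ≤ 2 * (1 - ‖z‖)) :
    ‖∑' k, a k * z ^ k‖ ≤ 2 * (1 - ‖z‖) * (n0 * M) + 2 * η := by
  have hM0 : 0 ≤ M := (norm_nonneg _).trans (hM 0)
  set w := z / ee t with hw
  have hwn : ‖w‖ = ‖z‖ := by rw [hw, norm_div, norm_ee, div_one]
  have h1w : ‖1 - w‖ = ‖ee t - z‖ := by
    have : 1 - w = (ee t - z) / ee t := by rw [hw, sub_div, div_self (ee_ne t)]
    rw [this, norm_div, norm_ee, div_one]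
  have hterm : ∀ k, a k * z ^ k = (a k * ee t ^ k) * w ^ k := by
    intro k
    rw [hw, div_pow]
    have := pow_ne_zero k (ee_ne t)
    field_simp
  have hsum := (summable_pow (coeff_bound hM) hz).hasSum.tendsto_sum_nat
  have hpos : 0 < 1 - ‖z‖ := by linarith
  have hpart : ∀ n, ‖∑ k ∈ Finset.range n, a k * z ^ k‖ ≤
      ‖ee t - z‖ * (n0 * M + η / (1 - ‖z‖)) + M * ‖z‖ ^ n := by
    intro n
    simp_rw [hterm]
    rw [abel_parts]
    refine (norm_add_le _ _).trans ?_
    rw [norm_mul, norm_mul, h1w, norm_pow, hwn]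
    gcongr
    · refine (norm_sum_le _ _).trans ?_
      calc ∑ k ∈ Finset.range n, ‖(∑ j ∈ Finset.range (k + 1), a j * ee t ^ j) * w ^ k‖
          ≤ ∑ k ∈ Finset.range n, ((if k < n0 then M else 0) + η * ‖z‖ ^ k) := by
            refine Finset.sum_le_sum fun k _ => ?_
            rw [norm_mul, norm_pow, hwn]
            have hp1 : ‖z‖ ^ k ≤ 1 := pow_le_one₀ (norm_nonneg z) hz.le
            have hp0 : 0 ≤ ‖z‖ ^ k := by positivity
            have e1 := hM (k + 1)
            unfold ss at e1
            split_ifs with hk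
            · nlinarith [mul_nonneg hη hp0]
            · have e2 := h0 (k + 1) (by omega)
              unfold ss at e2
              rw [zero_add]
              gcongr
        _ = (∑ k ∈ Finset.range n, (if k < n0 then M else 0)) + η * ∑ k ∈ Finset.range n, ‖z‖ ^ k := by
            rw [Finset.sum_add_distrib, Finset.mul_sum]
        _ ≤ n0 * M + η / (1 - ‖z‖) := by
            gcongr
            · rw [← Finset.sum_filter, Finset.sum_const, nsmul_eq_mul]
              gcongr
              have : Finset.filter (fun k => k < n0) (Finset.range n) ⊆ Finset.range n0 := by
                intro k hk; simp at hk ⊢; exact hk.2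
              simpa using Finset.card_le_card this
            · rw [div_eq_mul_inv]
              gcongr
              rw [← tsum_geometric_of_lt_one (norm_nonneg z) hz]
              exact (summable_geometric_of_lt_one (norm_nonneg z) hz).sum_le_tsum _
                fun _ _ => by positivity
    · exact hM n
  have hlim : Tendsto (fun n : ℕ => ‖ee t - z‖ * (n0 * M + η / (1 - ‖z‖)) + M * ‖z‖ ^ n) atTop
      (𝓝 (‖ee t - z‖ * (n0 * M + η / (1 - ‖z‖)) + M * 0)) :=
    tendsto_const_nhds.add ((tendsto_pow_atTop_nhds_zero_of_lt_one (norm_nonneg z) hz).const_mul M)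
  have hfin := le_of_tendsto_of_tendsto' hsum.norm hlim hpart
  refine hfin.trans ?_
  rw [mul_zero, add_zero]
  have hq : 0 ≤ n0 * M + η / (1 - ‖z‖) := by positivity
  calc ‖ee t - z‖ * (n0 * M + η / (1 - ‖z‖))
      ≤ 2 * (1 - ‖z‖) * (n0 * M + η / (1 - ‖z‖)) := by gcongr
    _ = _ := by field_simp

lemma separated {E K : Set TT} (hE : IsClosed E) (hK : IsClosed K) (hd : Disjoint E K) :
    ∃ d > 0, ∀ x ∈ E, ∀ y ∈ K, d ≤ ‖ee x - ee y‖ := by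
  have h1 : IsCompact (ee '' E) := hE.isCompact.image continuous_ee
  have h2 : IsClosed (ee '' K) := (hK.isCompact.image continuous_ee).isClosed
  have h3 : Disjoint (ee '' E) (ee '' K) := (Set.disjoint_image_iff ee_injective).2 hd
  obtain ⟨d, hd0, hd⟩ := h3.exists_thickenings h1 h2
  refine ⟨d, hd0, fun x hx y hy => ?_⟩
  by_contra! hlt
  refine (Set.disjoint_left.1 hd : ∀ ⦃a⦄, _) (a := ee y) ?_ ?_
  · rw [Metric.mem_thickening_iff]
    exact ⟨ee x, ⟨x, hx, rfl⟩, by rwa [dist_eq_norm, norm_sub_rev]⟩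
  · exact Metric.self_subset_thickening hd0 _ ⟨y, hy, rfl⟩

end MenshovAux

namespace MenshovAux

lemma exists_radius (g₁ g₂ g₃ : ℝ → ℝ) (h₁ : Continuous g₁) (h₂ : Continuous g₂)
    (h₃ : Continuous g₃) (e₁ : g₁ 1 = 0) (e₂ : g₂ 1 = 0) (e₃ : g₃ 1 = 0) {A B C : ℝ}
    (hA : 0 < A) (hB : 0 < B) (hC : 0 < C) :
    ∃ r, 0 < r ∧ r < 1 ∧ g₁ r < A ∧ g₂ r < B ∧ g₃ r < C := by
  have t₁ : ∀ᶠ r in 𝓝[<] (1 : ℝ), g₁ r < A :=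
    nhdsWithin_le_nhds ((h₁.tendsto 1).eventually_lt_const (by rw [e₁]; exact hA))
  have t₂ : ∀ᶠ r in 𝓝[<] (1 : ℝ), g₂ r < B :=
    nhdsWithin_le_nhds ((h₂.tendsto 1).eventually_lt_const (by rw [e₂]; exact hB))
  have t₃ : ∀ᶠ r in 𝓝[<] (1 : ℝ), g₃ r < C :=
    nhdsWithin_le_nhds ((h₃.tendsto 1).eventually_lt_const (by rw [e₃]; exact hC))
  have t₄ : ∀ᶠ r in 𝓝[<] (1 : ℝ), 0 < r :=
    nhdsWithin_le_nhds (eventually_gt_nhds one_pos)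
  have t₅ : ∀ᶠ r in 𝓝[<] (1 : ℝ), r < 1 := eventually_mem_nhdsWithin
  obtain ⟨r, a, b, c, d, e⟩ := (t₁.and (t₂.and (t₃.and (t₄.and t₅)))).exists
  exact ⟨r, d, e, a, b, c⟩

lemma core_bound {a : ℕ → ℂ} {E K : Set TT} (hE : IsClosed E) (hK : IsClosed K)
    (hd : Disjoint E K) {M : ℝ} (hM0 : 0 ≤ M) (hM : ∀ t ∈ E ∪ K, ∀ N, ‖ss a N t‖ ≤ M)
    (hunif : ∀ η > 0, ∃ n0 : ℕ, ∀ t ∈ E, ∀ N ≥ n0, ‖ss a N t‖ ≤ η)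
    (hne : (E ∪ K).Nonempty)
    (hB : volume.real (E ∪ K)ᶜ < 1 / 4) {L : ℝ} (hL : 0 < L) :
    ‖a 0‖ * Real.exp (L * (volume.real E - 8 * π * volume.real (E ∪ K)ᶜ))
      ≤ 2 * (M + 1) * Real.exp 1 := by
  have hpi := Real.pi_pos
  obtain ⟨t₁, ht₁⟩ := hne
  have ha := coeff_bound (hM t₁ ht₁)
  set B := (E ∪ K)ᶜ with hBdef
  obtain ⟨d, hd0, hsep⟩ := separated hE hK hd
  set η : ℝ := (M + 1) * Real.exp (-(2 * π * L)) / 2 with hη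
  have hη0 : 0 < η := by positivity
  obtain ⟨n0, hn0⟩ := hunif η hη0
  obtain ⟨r, hr0, hr1, hr2, hr3, hr4⟩ := exists_radius (fun r => 2 * (1 - r) * (n0 * M))
    (fun r => 2 * (1 - r)) (fun r => L * ((1 - r ^ 2) / (d / 2) ^ 2 * (2 * π)))
    (by fun_prop) (by fun_prop) (by fun_prop) (by simp) (by simp) (by simp)
    (A := 2 * η) (B := d / 2) (C := 1) (by positivity) (by positivity) one_pos
  set F : ℂ → ℂ := fun z => ∑' k, a k * z ^ k with hF
  set Φ : ℂ → ℂ := fun z => F z * Complex.exp (L * (HZ E z - 8 * π * HZ B z)) with hΦ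
  have hΦn : ∀ z, ‖Φ z‖ = ‖F z‖ * Real.exp (L * ((HZ E z).re - 8 * π * (HZ B z).re)) := by
    intro z
    rw [hΦ]
    simp only [norm_mul, Complex.norm_exp]
    congr 2
    have : (L : ℂ) * (HZ E z - 8 * π * HZ B z) = (L : ℂ) * (HZ E z - ((8 * π : ℝ) : ℂ) * HZ B z) := by
      push_cast; ring
    rw [this, Complex.re_ofReal_mul, Complex.sub_re, Complex.re_ofReal_mul]
  set U : Set ℂ := {z | ‖z‖ < r ∧ (HZ B z).re < 1 / 4} with hU
  have hcontB : ∀ z : ℂ, ‖z‖ < 1 → ContinuousAt (fun z => (HZ B z).re) z := by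
    intro z hz
    have := ((HZ_diff B).differentiableAt (Metric.isOpen_ball.mem_nhds (by simpa using hz))).continuousAt
    exact Complex.continuous_re.continuousAt.comp this
  have hcl : ∀ z ∈ closure U, ‖z‖ ≤ r ∧ (HZ B z).re ≤ 1 / 4 := by
    intro z hz
    have h1 : ‖z‖ ≤ r := by
      have : closure U ⊆ {z : ℂ | ‖z‖ ≤ r} :=
        closure_minimal (fun z hz => hz.1.le) (isClosed_le continuous_norm continuous_const)
      exact this hz
    refine ⟨h1, ?_⟩
    by_contra! hlt
    have hev := (hcontB z (by linarith)).eventually_const_lt hlt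
    obtain ⟨y, hy1, hy2⟩ := (mem_closure_iff_frequently.1 hz).and_eventually hev |>.exists
    exact absurd hy1.2 (not_lt.2 hy2.le)
  have hdiff : DifferentiableOn ℂ Φ (closure U) := by
    have hsub : closure U ⊆ Metric.ball 0 ((1 + r) / 2) := by
      intro z hz
      have := (hcl z hz).1
      simp only [Metric.mem_ball, dist_zero_right]; linarith
    have hsub1 : closure U ⊆ Metric.ball 0 1 := by
      intro z hz
      have := (hcl z hz).1
      simp only [Metric.mem_ball, dist_zero_right]; linarith
    have d1 : DifferentiableOn ℂ F (closure U) :=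
      (diff_pow ha (r := (1 + r) / 2) (by linarith) (by linarith)).mono hsub
    have d2 := (HZ_diff E).mono hsub1
    have d3 := (HZ_diff B).mono hsub1
    exact d1.mul (((d2.sub (d3.const_mul _)).const_mul _).cexp)
  have hbd : Bornology.IsBounded U :=
    (Metric.isBounded_ball (x := (0 : ℂ)) (r := r)).subset fun z hz => by simpa using hz.1
  have h0U : (0 : ℂ) ∈ closure U := by
    refine subset_closure ⟨by simpa using hr0, ?_⟩
    rw [HZ_zero]; exact hB
  have hmain : ‖Φ 0‖ ≤ 2 * (M + 1) * Real.exp 1 := by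
    refine Complex.norm_le_of_forall_mem_frontier_norm_le hbd hdiff.diffContOnCl ?_ h0U
    intro z hz
    obtain ⟨hzr, hzB⟩ := hcl z hz.1
    have hz1 : ‖z‖ < 1 := by linarith
    have hcase : ‖z‖ = r ∨ 1 / 4 ≤ (HZ B z).re := by
      by_contra! hcon
      apply hz.2
      rw [mem_interior_iff_mem_nhds]
      have e1 : ∀ᶠ y in 𝓝 z, ‖y‖ < r :=
        (continuous_norm.tendsto z).eventually_lt_const (lt_of_le_of_ne hzr hcon.1)
      have e2 := (hcontB z hz1).eventually_lt_const hcon.2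
      filter_upwards [e1, e2] with y h1 h2 using ⟨h1, h2⟩
    have hPB : (HZ B z).re = ∫ t in B, ker z t := HZ_re B hz1
    have hPE : (HZ E z).re = ∫ t in E, ker z t := HZ_re E hz1
    obtain ⟨t, htB, htz⟩ := exists_near hz1 B (by rw [← hPB]; linarith)
    have ht : t ∈ E ∪ K := not_not.1 htB
    have hFM : ‖F z‖ ≤ 2 * (M + 1) := by
      have := abel_bound (n0 := 0) hM0 (hM t ht) (fun N _ => hM t ht N) hz1 htz
      simp only [CharP.cast_eq_zero, zero_mul, mul_zero, zero_add] at this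
      exact this.trans (by linarith)
    have hPB0 : 0 ≤ (HZ B z).re := by
      rw [hPB]; exact integral_nonneg fun t => ker_nonneg hz1 t
    have hPE2 : (HZ E z).re ≤ 2 * π := by rw [hPE]; exact ker_le_total hz1 E
    rw [hΦn]
    rcases hcase with hzr' | h4
    · rcases ht with htE | htK
      · have hFs : ‖F z‖ ≤ 2 * (M + 1) * Real.exp (-(2 * π * L)) := by
          have := abel_bound hη0.le (hM t (Or.inl htE)) (hn0 t htE) hz1 htz
          rw [hzr'] at this
          refine this.trans ?_
          have : 2 * (M + 1) * Real.exp (-(2 * π * L)) = 2 * η + 2 * η := by rw [hη]; ring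
          linarith
        calc ‖F z‖ * Real.exp (L * ((HZ E z).re - 8 * π * (HZ B z).re))
            ≤ (2 * (M + 1) * Real.exp (-(2 * π * L))) * Real.exp (2 * π * L) := by
              have h1 : (HZ E z).re - 8 * π * (HZ B z).re ≤ 2 * π := by
                have : 0 ≤ 8 * π * (HZ B z).re := by positivity
                linarith
              have h2 : L * ((HZ E z).re - 8 * π * (HZ B z).re) ≤ 2 * π * L := by nlinarith
              exact mul_le_mul hFs (Real.exp_le_exp.2 h2) (Real.exp_pos _).le (by positivity)
          _ = 2 * (M + 1) * 1 := by
              rw [mul_assoc, ← Real.exp_add]; simp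
          _ ≤ _ := by
              gcongr
              exact Real.one_le_exp zero_le_one
      · have hPs : (HZ E z).re ≤ (1 - r ^ 2) / (d / 2) ^ 2 * (2 * π) := by
          rw [hPE]
          have hc : 0 ≤ (1 - r ^ 2) / (d / 2) ^ 2 := by
            have : r ^ 2 ≤ 1 := by nlinarith
            exact div_nonneg (by linarith) (by positivity)
          have hm := setIntegral_mono_on (μ := volume) (s := E)
            (f := ker z) (g := fun _ => (1 - r ^ 2) / (d / 2) ^ 2) (integrable_ker hz1 _)
            (integrable_const _) hE.measurableSet ?_
          · refine hm.trans ?_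
            rw [setIntegral_const, smul_eq_mul, mul_comm]
            gcongr
            have h1 : volume.real E ≤ volume.real (Set.univ : Set TT) := measureReal_mono (Set.subset_univ _)
            refine h1.trans ?_
            rw [Measure.real, AddCircle.measure_univ, ENNReal.toReal_ofReal (by positivity)]
          · intro x hx
            have h1 := hsep x hx t htK
            have h2 : d / 2 ≤ ‖ee x - z‖ := by
              have h3 : ‖ee x - ee t‖ ≤ ‖ee x - z‖ + ‖ee t - z‖ := by
                have := norm_sub_le (ee x - z) (ee t - z)
                simpa using this
              rw [hzr'] at htz
              linarith
            unfold ker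
            rw [hzr']
            have : r ^ 2 ≤ 1 := by nlinarith
            gcongr
        have hv : L * ((HZ E z).re - 8 * π * (HZ B z).re) ≤ 1 := by
          have h1 : 0 ≤ 8 * π * (HZ B z).re := by positivity
          have h2 : L * ((HZ E z).re - 8 * π * (HZ B z).re) ≤ L * ((1 - r ^ 2) / (d / 2) ^ 2 * (2 * π)) := by
            gcongr; linarith
          linarith
        gcongr
    · have hv : L * ((HZ E z).re - 8 * π * (HZ B z).re) ≤ 1 := by
        have h1 : (HZ E z).re - 8 * π * (HZ B z).re ≤ 0 := by nlinarith
        nlinarith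
      gcongr
  rw [hΦn, HZ_zero, HZ_zero] at hmain
  have hF0 : F 0 = a 0 := by
    rw [hF]
    simp only
    rw [tsum_eq_single 0]
    · simp
    · intro k hk; simp [hk]
  rwa [hF0] at hmain

lemma core {a : ℕ → ℂ} {E K : Set TT} (hE : IsClosed E) (hK : IsClosed K)
    (hd : Disjoint E K) {M : ℝ} (hM : ∀ t ∈ E ∪ K, ∀ N, ‖ss a N t‖ ≤ M)
    (hunif : ∀ η > 0, ∃ n0 : ℕ, ∀ t ∈ E, ∀ N ≥ n0, ‖ss a N t‖ ≤ η)
    (hB : 8 * π * volume.real (E ∪ K)ᶜ < volume.real E) : a 0 = 0 := by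
  have hpi := Real.pi_pos
  have hE2 : volume.real E ≤ 2 * π := by
    have h1 : volume.real E ≤ volume.real (Set.univ : Set TT) := measureReal_mono (Set.subset_univ _)
    refine h1.trans ?_
    rw [Measure.real, AddCircle.measure_univ, ENNReal.toReal_ofReal (by positivity)]
  have hB4 : volume.real (E ∪ K)ᶜ < 1 / 4 := by
    by_contra! h; nlinarith
  have hne : (E ∪ K).Nonempty := by
    rw [Set.nonempty_iff_ne_empty]
    intro h
    have h2 : E = ∅ := (Set.union_empty_iff.1 h).1
    have h3 : volume.real E = 0 := by simp [h2]
    have h4 : 0 ≤ 8 * π * volume.real (E ∪ K)ᶜ := by positivity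
    linarith
  have hM0 : 0 ≤ M := by
    obtain ⟨t, ht⟩ := hne
    exact (norm_nonneg _).trans (hM t ht 0)
  by_contra ha
  have ha' : 0 < ‖a 0‖ := norm_pos_iff.2 ha
  set v := volume.real E - 8 * π * volume.real (E ∪ K)ᶜ with hv
  have hv0 : 0 < v := by rw [hv]; linarith
  set C := 2 * (M + 1) * Real.exp 1 with hC
  have hC0 : 0 < C := by positivity
  have h := core_bound hE hK hd hM0 hM hunif hne hB4 (L := C / (‖a 0‖ * v)) (by positivity)
  rw [← hv, ← hC] at h
  have h2 : C / (‖a 0‖ * v) * v = C / ‖a 0‖ := by field_simp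
  rw [h2] at h
  have h3 := Real.add_one_le_exp (C / ‖a 0‖)
  have h4 : ‖a 0‖ * (C / ‖a 0‖ + 1) ≤ C := le_trans (by gcongr) h
  have h5 : ‖a 0‖ * (C / ‖a 0‖ + 1) = C + ‖a 0‖ := by field_simp
  linarith

end MenshovAux

namespace MenshovAux

lemma privalov {a : ℕ → ℂ} {g : TT → ℂ} (hg : Measurable g)
    (hlim : ∀ᵐ t : TT, Tendsto (fun N => ss a N t) atTop (𝓝 (g t)))
    (hpos : 0 < volume {t : TT | g t = 0}) : a 0 = 0 := by
  have hpi := Real.pi_pos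
  set E : Set TT := {t | g t = 0} with hE
  have hEm : MeasurableSet E := hg (measurableSet_singleton 0)
  set e := volume.real E with he
  have he0 : 0 < e := ENNReal.toReal_pos hpos.ne' (measure_ne_top _ _)
  set ε := e / 200 with hε
  have hε0 : 0 < ε := by positivity
  have hofε : ENNReal.ofReal ε ≠ 0 := by simpa using hε0
  obtain ⟨Z, hZm, hZ, hZu⟩ := tendstoUniformlyOn_of_ae_tendsto' (μ := (volume : Measure TT))
    (fun n => (continuous_ss a n).stronglyMeasurable) hg.stronglyMeasurable hlim hε0
  set A : ℕ → Set TT := fun M => {t | ∀ N, ‖ss a N t‖ ≤ M} with hA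
  have hAc : ∀ M, IsClosed (A M) := by
    intro M
    have : A M = ⋂ N, {t | ‖ss a N t‖ ≤ M} := by ext t; simp [hA]
    rw [this]
    exact isClosed_iInter fun N => isClosed_le (continuous_ss a N).norm continuous_const
  have hAmono : Antitone fun M => (A M)ᶜ := by
    intro M M' h
    apply Set.compl_subset_compl.2
    intro t ht N
    exact (ht N).trans (by exact_mod_cast h)
  have hA0 : volume (⋂ M, (A M)ᶜ) = 0 := by
    refine measure_mono_null ?_ hlim
    intro t ht hconv
    obtain ⟨C, hC⟩ := hconv.norm.bddAbove_range
    obtain ⟨M, hM⟩ := exists_nat_ge C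
    refine (Set.mem_iInter.1 ht M) fun N => ?_
    exact (hC ⟨N, rfl⟩).trans hM
  have hAt := tendsto_measure_iInter_atTop (μ := (volume : Measure TT)) (s := fun M => (A M)ᶜ)
    (fun M => (hAc M).measurableSet.compl.nullMeasurableSet) hAmono ⟨0, measure_ne_top _ _⟩
  rw [hA0] at hAt
  obtain ⟨M, hM⟩ := (hAt.eventually_lt_const (pos_iff_ne_zero.2 hofε)).exists
  have hm1 : MeasurableSet ((E ∩ A M) \ Z) := (hEm.inter (hAc M).measurableSet).diff hZm
  have hm2 : MeasurableSet (A M \ E) := (hAc M).measurableSet.diff hEm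
  obtain ⟨E1, hE1s, hE1c, hE1⟩ := hm1.exists_isClosed_sdiff_lt (μ := volume) (measure_ne_top _ _) hofε
  obtain ⟨K1, hK1s, hK1c, hK1⟩ := hm2.exists_isClosed_sdiff_lt (μ := volume) (measure_ne_top _ _) hofε
  have conv : ∀ S : Set TT, volume S ≤ ENNReal.ofReal ε → volume.real S ≤ ε := fun S hS =>
    ENNReal.toReal_le_of_le_ofReal hε0.le hS
  have b1 := conv _ hZ
  have b2 := conv _ hM.le
  have b3 := conv _ hE1.le
  have b4 := conv _ hK1.le
  have hBsub : (E1 ∪ K1)ᶜ ⊆ (Z ∪ (A M)ᶜ) ∪ ((((E ∩ A M) \ Z) \ E1) ∪ ((A M \ E) \ K1)) := by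
    intro t ht
    simp only [Set.mem_compl_iff, Set.mem_union, Set.mem_sdiff, Set.mem_inter_iff] at ht ⊢
    tauto
  have hB : volume.real (E1 ∪ K1)ᶜ ≤ 4 * ε := by
    have c1 := measureReal_mono (μ := volume) hBsub
    have c2 := measureReal_union_le (μ := volume) (Z ∪ (A M)ᶜ)
      ((((E ∩ A M) \ Z) \ E1) ∪ ((A M \ E) \ K1))
    have c3 := measureReal_union_le (μ := volume) Z (A M)ᶜ
    have c4 := measureReal_union_le (μ := volume) (((E ∩ A M) \ Z) \ E1) ((A M \ E) \ K1)
    linarith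
  have hEsub : E ⊆ E1 ∪ (E1 ∪ K1)ᶜ := by
    intro t ht
    by_cases h1 : t ∈ E1
    · exact Or.inl h1
    · refine Or.inr fun h => ?_
      rcases h with h | h
      · exact h1 h
      · exact (hK1s h).2 ht
  have hE1m : e ≤ volume.real E1 + 4 * ε := by
    have c1 := measureReal_mono (μ := volume) hEsub
    have c2 := measureReal_union_le (μ := volume) E1 (E1 ∪ K1)ᶜ
    linarith
  refine core hE1c hK1c ?_ (M := M) ?_ ?_ ?_
  · rw [Set.disjoint_left]
    intro t h1 h2
    exact (hK1s h2).2 (hE1s h1).1.1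
  · rintro t (h | h) N
    · exact (hE1s h).1.2 N
    · exact (hK1s h).1 N
  · intro η hη
    obtain ⟨n0, hn0⟩ := eventually_atTop.1 (Metric.tendstoUniformlyOn_iff.1 hZu η hη)
    refine ⟨n0, fun t ht N hN => ?_⟩
    have h1 := hn0 N hN t (hE1s ht).2
    have h2 : g t = 0 := (hE1s ht).1.1
    rw [h2, dist_zero_left] at h1
    exact h1.le
  · have h1 := Real.pi_lt_d2
    have h2 : 8 * π * volume.real (E1 ∪ K1)ᶜ ≤ 8 * 3.15 * (4 * ε) := by gcongr
    have h3 : e = 200 * ε := by rw [hε]; ring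
    linarith

lemma second_part (f : TT → ℂ) (hf : Measurable f)
    (hpos : 0 < volume {t : TT | f t = 0}) (hne : ¬ f =ᵐ[volume] (0 : TT → ℂ)) :
    ¬ ∃ c : ℕ → ℂ, ∀ᵐ t : TT,
        Tendsto (fun N => analyticPartialSum c N t) atTop (𝓝 (f t)) := by
  rintro ⟨c, hc⟩
  have hps : ∀ N t, analyticPartialSum c N t = ∑ k ∈ Finset.range N, c (k + 1) * ee t ^ (k + 1) := by
    intro N t
    unfold analyticPartialSum
    simp_rw [fourier_eq]
    rw [← Finset.sum_image (g := fun k => k + 1) (f := fun k => c k * ee t ^ k) (by simp)]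
    congr 1
    ext k
    simp only [Finset.mem_Icc, Finset.mem_image, Finset.mem_range]
    constructor
    · rintro ⟨h1, h2⟩; exact ⟨k - 1, by omega, by omega⟩
    · rintro ⟨j, h1, rfl⟩; omega
  have hzero : ∀ m, c (m + 1) = 0 := by
    intro m
    induction m using Nat.strong_induction_on with
    | _ m ih =>
      have key : ∀ N t, ss (fun k => c (k + m + 1)) N t =
          (ee t ^ (m + 1))⁻¹ * analyticPartialSum c (N + m) t := by
        intro N t
        rw [hps, add_comm N m, Finset.sum_range_add, Finset.sum_eq_zero (s := Finset.range m), zero_add, Finset.mul_sum]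
        · unfold ss
          refine Finset.sum_congr rfl fun k _ => ?_
          have := pow_ne_zero (m + 1) (ee_ne t)
          rw [add_comm m k]
          field_simp
          ring
        · intro k hk
          rw [ih k (Finset.mem_range.1 hk), zero_mul]
      have := privalov (a := fun k => c (k + m + 1)) (g := fun t => (ee t ^ (m + 1))⁻¹ * f t)
        (((continuous_ee.pow (m + 1)).measurable.inv).mul hf) ?_ ?_
      · simpa using this
      · filter_upwards [hc] with t ht
        simp_rw [key]
        exact (ht.comp (tendsto_add_atTop_nat m)).const_mul _
      · have : {t : TT | (ee t ^ (m + 1))⁻¹ * f t = 0} = {t | f t = 0} := by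
          ext t; simp [ee_ne]
        rwa [this]
  apply hne
  filter_upwards [hc] with t ht
  have : ∀ N, analyticPartialSum c N t = 0 := by
    intro N; rw [hps]; exact Finset.sum_eq_zero fun k _ => by rw [hzero, zero_mul]
  simp_rw [this] at ht
  exact tendsto_nhds_unique ht tendsto_const_nhds

end MenshovAux

/-- **`ℤ⁺` is not a Menshov spectrum**: there is a measurable `f : 𝕋 → ℂ` admitting no
expansion `f(t) = ∑_{k>0} c_k e^{ikt}` with partial sums converging a.e.; in fact, no
measurable `f` vanishing on a set of positive measure but not a.e. zero admits such a
representation. -/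
theorem pos_integers_not_menshov_spectrum :
    (∃ f : AddCircle (2 * π) → ℂ, Measurable f ∧
      ¬ ∃ c : ℕ → ℂ, ∀ᵐ t : AddCircle (2 * π),
        Tendsto (fun N => analyticPartialSum c N t) atTop (𝓝 (f t))) ∧
    (∀ f : AddCircle (2 * π) → ℂ, Measurable f →
      0 < volume {t : AddCircle (2 * π) | f t = 0} →
      ¬ f =ᵐ[volume] (0 : AddCircle (2 * π) → ℂ) →
      ¬ ∃ c : ℕ → ℂ, ∀ᵐ t : AddCircle (2 * π),
        Tendsto (fun N => analyticPartialSum c N t) atTop (𝓝 (f t))) := by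
  refine ⟨?_, MenshovAux.second_part⟩
  have hpi := Real.pi_gt_three
  have hBm : MeasurableSet (Metric.closedBall (0 : AddCircle (2 * π)) 1) :=
    Metric.isClosed_closedBall.measurableSet
  have hvol : volume (Metric.closedBall (0 : AddCircle (2 * π)) 1) = ENNReal.ofReal 2 := by
    rw [AddCircle.volume_closedBall, min_eq_right (by linarith), mul_one]
  set f : AddCircle (2 * π) → ℂ :=
    Set.indicator (Metric.closedBall (0 : AddCircle (2 * π)) 1) (fun _ => 1) with hf
  have hfm : Measurable f := measurable_const.indicator hBm
  refine ⟨f, hfm, MenshovAux.second_part f hfm ?_ ?_⟩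
  · have h1 : {t | f t = 0} = (Metric.closedBall (0 : AddCircle (2 * π)) 1)ᶜ := by
      ext t; simp [hf]
    rw [h1, measure_compl hBm (measure_ne_top _ _), hvol, AddCircle.measure_univ]
    exact tsub_pos_of_lt ((ENNReal.ofReal_lt_ofReal_iff (by linarith)).2 (by linarith))
  · intro h
    have h2 : volume {t | ¬ f t = (0 : AddCircle (2 * π) → ℂ) t} = 0 := h
    have h1 : {t | ¬ f t = (0 : AddCircle (2 * π) → ℂ) t}
        = Metric.closedBall (0 : AddCircle (2 * π)) 1 := by
      ext t; simp [hf]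
    rw [h1, hvol] at h2
    simp at h2
end

section
/- If F(z) = ∑_{k>0} c_k z^k is analytic on the open unit disc and there exists a set E ⊆ 𝕋 of positive Lebesgue measure such that for every t ∈ E the non-tangential limit of F at e^{it} exists and equals 0, then F is identically zero (equivalently, all coefficients c_k vanish). (Lusin–Privalov uniqueness theorem, as used in the paper.) -/
open MeasureTheory Filter Topology Real Complex

/-- The Stolz angle (non-tangential approach region) at the boundary point `w` of the
unit disc, with aperture constant `C`: points `z` of the open unit disc with
`‖z - w‖ ≤ C (1 - ‖z‖)`. -/
def stolzAngle (w : ℂ) (C : ℝ) : Set ℂ :=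
  {z : ℂ | ‖z - w‖ ≤ C * (1 - ‖z‖) ∧ ‖z‖ < 1}


noncomputable def lpP (A : Set ℝ) (w : ℂ) : ℝ := ∫ t in A, w.im / ((w.re - t) ^ 2 + w.im ^ 2)

noncomputable def lpG (A : Set ℝ) (w : ℂ) : ℂ := ∫ t in A, Complex.I / (w - (t : ℂ))

def lpB (f : ℂ → ℂ) (h ε : ℝ) : Set ℝ :=
  {t : ℝ | ∀ w : ℂ, 0 < w.im → w.im < h → |w.re - t| < 2 * w.im → ‖f w‖ ≤ ε}

lemma lp_im_le (w : ℂ) (t : ℝ) : w.im ≤ ‖w - (t : ℂ)‖ := by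
  have := Complex.abs_im_le_norm (w - (t : ℂ))
  simp at this
  exact (le_abs_self _).trans this

lemma lp_ne {w : ℂ} (hw : 0 < w.im) (t : ℝ) : w - (t : ℂ) ≠ 0 := by
  have := lp_im_le w t
  exact norm_pos_iff.1 (hw.trans_le this)

lemma lp_cont {w : ℂ} (hw : 0 < w.im) : Continuous fun t : ℝ => Complex.I / (w - (t : ℂ)) := by
  refine continuous_const.div (by fun_prop) (lp_ne hw)

lemma lp_int {w : ℂ} (hw : 0 < w.im) {A : Set ℝ} (hA : volume A ≠ ⊤) :
    IntegrableOn (fun t : ℝ => Complex.I / (w - (t : ℂ))) A := by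
  refine Measure.integrableOn_of_bounded (M := 1 / w.im) hA (lp_cont hw).aestronglyMeasurable ?_
  refine Eventually.of_forall fun t => ?_
  rw [norm_div, Complex.norm_I]
  exact one_div_le_one_div_of_le hw (lp_im_le w t)

lemma lp_re {w : ℂ} (t : ℝ) :
    (Complex.I / (w - (t : ℂ))).re = w.im / ((w.re - t) ^ 2 + w.im ^ 2) := by
  rw [Complex.div_re]
  simp [Complex.normSq_apply]
  ring

lemma lp_intP {w : ℂ} (hw : 0 < w.im) {A : Set ℝ} (hA : volume A ≠ ⊤) :
    IntegrableOn (fun t : ℝ => w.im / ((w.re - t) ^ 2 + w.im ^ 2)) A := by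
  have := (lp_int hw hA).re
  refine this.congr (Eventually.of_forall fun t => ?_)
  exact lp_re t

lemma lp_G_re {w : ℂ} (hw : 0 < w.im) {A : Set ℝ} (hA : volume A ≠ ⊤) :
    (lpG A w).re = lpP A w := by
  have := integral_re (lp_int hw hA)
  unfold lpG lpP
  refine Eq.trans this.symm ?_
  exact integral_congr_ae (Eventually.of_forall fun t => lp_re t)

lemma lp_G_diff {w : ℂ} (hw : 0 < w.im) {A : Set ℝ} (hA : volume A ≠ ⊤) :
    DifferentiableAt ℂ (lpG A) w := by
  have hb : ∀ x ∈ Metric.ball w (w.im / 2), w.im / 2 < x.im := by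
    intro x hx
    rw [Metric.mem_ball, dist_eq_norm] at hx
    have h1 := Complex.abs_im_le_norm (x - w)
    rw [Complex.sub_im] at h1
    have := neg_abs_le (x.im - w.im)
    linarith
  refine (hasDerivAt_integral_of_dominated_loc_of_deriv_le (μ := volume.restrict A)
    (F := fun (w : ℂ) (t : ℝ) => Complex.I / (w - (t : ℂ)))
    (F' := fun (w : ℂ) (t : ℝ) => -Complex.I / (w - (t : ℂ)) ^ 2)
    (bound := fun _ => 1 / (w.im / 2) ^ 2) (s := Metric.ball w (w.im / 2)) (x₀ := w)
    (Metric.ball_mem_nhds _ (by positivity)) ?_ (lp_int hw hA) ?_ ?_ ?_ ?_).2.differentiableAt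
  · filter_upwards [Metric.ball_mem_nhds w (half_pos hw)] with x hx
    exact (lp_cont ((half_pos hw).trans (hb x hx))).aestronglyMeasurable
  · refine Continuous.aestronglyMeasurable ?_
    exact continuous_const.div (by fun_prop) (fun t => pow_ne_zero _ (lp_ne hw t))
  · refine Eventually.of_forall fun t x hx => ?_
    rw [norm_div, norm_neg, Complex.norm_I, norm_pow]
    have := lp_im_le x t
    have := hb x hx
    gcongr
    linarith
  · have : IsFiniteMeasure (volume.restrict A) := ⟨by simpa using hA.lt_top⟩
    exact integrable_const _
  · refine Eventually.of_forall fun t x hx => ?_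
    have hx0 := lp_ne ((half_pos hw).trans (hb x hx)) t
    have := (hasDerivAt_const x Complex.I).div ((hasDerivAt_id x).sub_const (t : ℂ)) hx0
    refine this.congr_deriv ?_
    simp

lemma lp_ker_nonneg {w : ℂ} (hw : 0 < w.im) (t : ℝ) :
    0 ≤ w.im / ((w.re - t) ^ 2 + w.im ^ 2) := by positivity

lemma lp_ker_le {w : ℂ} (hw : 0 < w.im) (t : ℝ) :
    w.im / ((w.re - t) ^ 2 + w.im ^ 2) ≤ 1 / w.im := by
  rw [div_le_div_iff₀ (by positivity) hw]
  nlinarith [sq_nonneg (w.re - t)]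

lemma lp_P_nonneg {w : ℂ} (hw : 0 < w.im) (A : Set ℝ) : 0 ≤ lpP A w :=
  integral_nonneg fun t => lp_ker_nonneg hw t

lemma lp_P_mono {w : ℂ} (hw : 0 < w.im) {A A' : Set ℝ} (hA' : volume A' ≠ ⊤) (h : A ⊆ A') :
    lpP A w ≤ lpP A' w :=
  setIntegral_mono_set (lp_intP hw hA') (Eventually.of_forall fun t => lp_ker_nonneg hw t)
    h.eventuallyLE

lemma lp_P_le {w : ℂ} (hw : 0 < w.im) {A : Set ℝ} (hA : volume A ≠ ⊤) :
    lpP A w ≤ volume.real A / w.im := by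
  have h1 : lpP A w ≤ ∫ t in A, (1 / w.im) := by
    refine integral_mono (lp_intP hw hA) ?_ fun t => lp_ker_le hw t
    have : IsFiniteMeasure (volume.restrict A) := ⟨by simpa using hA.lt_top⟩
    exact integrable_const _
  refine h1.trans ?_
  simp [div_eq_mul_inv]

lemma lp_P_union {w : ℂ} (hw : 0 < w.im) {A A' D : Set ℝ} (hA' : volume A' ≠ ⊤)
    (hD : volume D ≠ ⊤) (hDm : MeasurableSet D) (h : A ⊆ A' ∪ D) :
    lpP A w ≤ lpP A' w + lpP D w := by
  have hu : volume (A' ∪ D) ≠ ⊤ := (measure_union_lt_top hA'.lt_top hD.lt_top).ne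
  have h2 : A ⊆ (A' \ D) ∪ D := by rwa [Set.sdiff_union_self]
  have hd : volume (A' \ D) ≠ ⊤ := ((measure_mono Set.sdiff_subset).trans_lt hA'.lt_top).ne
  have h3 : lpP ((A' \ D) ∪ D) w = lpP (A' \ D) w + lpP D w :=
    setIntegral_union Set.disjoint_sdiff_left hDm (lp_intP hw hd) (lp_intP hw hD)
  have h4 := lp_P_mono hw (by rwa [Set.sdiff_union_self]) h2
  have h5 : lpP (A' \ D) w ≤ lpP A' w := lp_P_mono hw hA' Set.sdiff_subset
  linarith

lemma lp_P_ge {w : ℂ} (hw : 0 < w.im) {A : Set ℝ} (hA : volume A ≠ ⊤)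
    (h : Set.Ioo (w.re - w.im) (w.re + w.im) ⊆ A) : 1 ≤ lpP A w := by
  refine le_trans ?_ (lp_P_mono hw hA h)
  have h1 : ∫ t in Set.Ioo (w.re - w.im) (w.re + w.im), (1 / (2 * w.im)) ≤
      lpP (Set.Ioo (w.re - w.im) (w.re + w.im)) w := by
    refine setIntegral_mono_on ?_ (lp_intP hw (by simp)) measurableSet_Ioo ?_
    · exact integrableOn_const (by simp)
    · intro t ht
      have h1 := ht.1
      have h2 := ht.2
      rw [div_le_div_iff₀ (by positivity) (by positivity)]
      nlinarith
  refine le_trans (le_of_eq ?_) h1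
  simp
  rw [max_eq_left (by linarith)]
  field_simp
  ring

lemma lp_B_closed (f : ℂ → ℂ) (h ε : ℝ) : IsClosed (lpB f h ε) := by
  have : lpB f h ε = ⋂ w : ℂ, {t : ℝ | 0 < w.im → w.im < h → |w.re - t| < 2 * w.im → ‖f w‖ ≤ ε} := by
    ext t; simp [lpB]
  rw [this]
  refine isClosed_iInter fun w => ?_
  by_cases hc : 0 < w.im ∧ w.im < h ∧ ¬ ‖f w‖ ≤ ε
  · have : {t : ℝ | 0 < w.im → w.im < h → |w.re - t| < 2 * w.im → ‖f w‖ ≤ ε}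
        = {t : ℝ | 2 * w.im ≤ |w.re - t|} := by
      ext t
      simp only [Set.mem_ofPred_eq]
      rw [← not_lt (a := |w.re - t|)]
      tauto
    rw [this]
    exact isClosed_le (by fun_prop) (by fun_prop)
  · have : {t : ℝ | 0 < w.im → w.im < h → |w.re - t| < 2 * w.im → ‖f w‖ ≤ ε} = Set.univ := by
      ext t
      simp only [Set.mem_ofPred_eq, Set.mem_univ, iff_true]
      tauto
    rw [this]; exact isClosed_univ

lemma lp_max (f : ℂ → ℂ) (hf : ∀ w : ℂ, 0 < w.im → DifferentiableAt ℂ f w) (K : Set ℝ)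
    (a b h N h' : ℝ) (hh : 0 < h) (hh1 : h ≤ 1) (hN : 0 ≤ N) (hh' : 0 < h')
    (hK : K ⊆ Set.Icc a b) (hK1 : K ⊆ lpB f (2 * h) 1)
    (hK2 : K ⊆ lpB f h' (Real.exp (-N))) (w : ℂ) (hw : 0 < w.im) (hwh : w.im < h)
    (hwr : w.re ∈ Set.Icc a b)
    (hP : lpP (Set.Icc (a - 3) (b + 3) \ K) w < 1) :
    ‖f w‖ ≤ Real.exp (-(N * (1 - (lpP (Set.Icc (a - 3) (b + 3) \ K) w + w.im / h)))) := by
  set A := Set.Icc (a - 3) (b + 3) \ K with hAdef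
  have hA : volume A ≠ ⊤ :=
    ((measure_mono Set.sdiff_subset).trans_lt (by simp : volume (Set.Icc (a - 3) (b + 3)) < ⊤)).ne
  set H : ℂ → ℂ := fun w => f w * Complex.exp (N * (1 - (lpG A w - Complex.I * w / h))) with hH
  have hHn : ∀ w : ℂ, 0 < w.im →
      ‖H w‖ = ‖f w‖ * Real.exp (N * (1 - (lpP A w + w.im / h))) := by
    intro w hw
    simp only [hH]
    rw [norm_mul, Complex.norm_exp, ← lp_G_re hw hA]
    congr 2
    rw [Complex.re_ofReal_mul]
    simp
    left
    ring
  have hHd : ∀ w : ℂ, 0 < w.im → DifferentiableAt ℂ H w := by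
    intro w hw
    have := lp_G_diff hw hA
    have := hf w hw
    simp only [hH]
    fun_prop
  set δ := min w.im h' / 2 with hδ
  have hm0 : 0 < min w.im h' := lt_min hw hh'
  have hδ0 : 0 < δ := by positivity
  have hδw : δ < w.im := by have := min_le_left w.im h'; linarith
  have hδh : δ < h' := by have := min_le_right w.im h'; linarith
  have hgap : ∀ z : ℂ, 0 < z.im → z.im ≤ h → (∃ t ∈ Set.Icc a b, |z.re - t| < 2 * z.im) →
      (¬ ∃ t ∈ K, |z.re - t| < z.im) → 1 ≤ lpP A z := by
    rintro z hz hzh ⟨t, ht, htz⟩ hno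
    refine lp_P_ge hz hA fun s hs => ⟨?_, fun hsK => hno ⟨s, hsK, ?_⟩⟩
    · rw [abs_lt] at htz
      exact ⟨by linarith [hs.1, ht.1], by linarith [hs.2, ht.2]⟩
    · rw [abs_lt]
      exact ⟨by linarith [hs.2], by linarith [hs.1]⟩
  set U : Set ℂ := {z | δ < z.im ∧ z.im < h ∧ ∃ t ∈ K, |z.re - t| < z.im} with hU
  have hUo : IsOpen U := by
    have : U = {z : ℂ | δ < z.im} ∩ ({z : ℂ | z.im < h} ∩ ⋃ t ∈ K, {z : ℂ | |z.re - t| < z.im}) := by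
      ext z; simp [hU]
    rw [this]
    refine (isOpen_lt (by fun_prop) (by fun_prop)).inter
      ((isOpen_lt (by fun_prop) (by fun_prop)).inter ?_)
    exact isOpen_biUnion fun t _ => isOpen_lt (by fun_prop) (by fun_prop)
  have hcl : ∀ z ∈ closure U, δ ≤ z.im ∧ z.im ≤ h ∧ ∃ t ∈ K, |z.re - t| < 2 * z.im := by
    intro z hz
    have h1 : δ ≤ z.im := by
      have : closure U ⊆ {z : ℂ | δ ≤ z.im} :=
        closure_minimal (fun z hz => hz.1.le) (isClosed_le (by fun_prop) (by fun_prop))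
      exact this hz
    have h2 : z.im ≤ h := by
      have : closure U ⊆ {z : ℂ | z.im ≤ h} :=
        closure_minimal (fun z hz => hz.2.1.le) (isClosed_le (by fun_prop) (by fun_prop))
      exact this hz
    refine ⟨h1, h2, ?_⟩
    obtain ⟨z', hz', hd⟩ := Metric.mem_closure_iff.1 hz (z.im / 2) (by linarith)
    obtain ⟨-, -, t, ht, htz⟩ := hz'
    refine ⟨t, ht, ?_⟩
    rw [dist_eq_norm] at hd
    have e1 := Complex.abs_re_le_norm (z - z')
    have e2 := Complex.abs_im_le_norm (z - z')
    rw [Complex.sub_re] at e1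
    rw [Complex.sub_im] at e2
    have e1' := abs_le.1 (e1.trans hd.le)
    have e2' := abs_lt.1 (e2.trans_lt hd)
    rw [abs_lt] at htz ⊢
    constructor <;> linarith [htz.1, htz.2, e1'.1, e1'.2, e2'.1, e2'.2]
  have hUb : Bornology.IsBounded U := by
    refine (Metric.isBounded_closedBall (x := (0 : ℂ)) (r := |a| + |b| + 2)).subset ?_
    rintro z ⟨h1, h2, t, ht, htz⟩
    rw [mem_closedBall_zero_iff]
    refine (Complex.norm_le_abs_re_add_abs_im z).trans ?_
    have := hK ht
    have e1 : |z.im| ≤ 1 := abs_le.2 ⟨by linarith, by linarith⟩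
    have e2 : |z.re| ≤ |a| + |b| + 1 := by
      rw [abs_lt] at htz
      rw [abs_le]
      constructor <;> linarith [this.1, this.2, neg_abs_le a, le_abs_self b, abs_nonneg a,
        abs_nonneg b, htz.1, htz.2]
    linarith
  have hwU : w ∈ U := by
    refine ⟨hδw, hwh, ?_⟩
    by_contra hno
    have := hgap w hw hwh.le ⟨w.re, hwr, by simpa using hw⟩ hno
    linarith
  have hbd : ∀ z ∈ frontier U, ‖H z‖ ≤ 1 := by
    intro z hz
    obtain ⟨h1, h2, t, ht, htz⟩ := hcl z hz.1
    have hz0 : 0 < z.im := by linarith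
    have hPz := lp_P_nonneg hz0 A
    have hyz : 0 ≤ z.im / h := by positivity
    rw [hHn z hz0]
    have hzU : z ∉ U := by rw [hUo.frontier_eq] at hz; exact hz.2
    by_cases c1 : z.im = δ
    · have := hK2 ht z hz0 (by linarith) htz
      calc ‖f z‖ * Real.exp (N * (1 - (lpP A z + z.im / h)))
          ≤ Real.exp (-N) * Real.exp (N * 1) := by gcongr; linarith
        _ = 1 := by rw [← Real.exp_add]; simp
    · have hf1 := hK1 ht z hz0 (by linarith) htz
      have hu : 1 ≤ lpP A z + z.im / h := by
        by_cases c2 : z.im = h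
        · rw [c2, div_self hh.ne']; linarith
        · have := hgap z hz0 h2 ⟨t, hK ht, htz⟩ fun hex =>
            hzU ⟨lt_of_le_of_ne h1 (Ne.symm c1), lt_of_le_of_ne h2 c2, hex⟩
          linarith
      have : Real.exp (N * (1 - (lpP A z + z.im / h))) ≤ 1 := by
        rw [Real.exp_le_one_iff]
        exact mul_nonpos_of_nonneg_of_nonpos hN (by linarith)
      exact mul_le_one₀ hf1 (Real.exp_pos _).le this
  have hdc : DiffContOnCl ℂ H U := by
    have hd : DifferentiableOn ℂ H (closure U) := fun z hz =>
      (hHd z (hδ0.trans_le (hcl z hz).1)).differentiableWithinAt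
    exact hd.diffContOnCl
  have := Complex.norm_le_of_forall_mem_frontier_norm_le hUb hdc hbd (subset_closure hwU)
  rw [hHn w hw] at this
  rw [Real.exp_neg, ← one_div]
  exact (le_div_iff₀ (Real.exp_pos _)).2 this

lemma lp_far_right {w : ℂ} (hw : 0 < w.im) {M : ℝ} (hM : 0 < M) (q : ℝ) :
    lpP (Set.Ioc (w.re + M * w.im) q) w ≤ 1 / M := by
  have hMw : 0 < M * w.im := by positivity
  rcases le_or_gt q (w.re + M * w.im) with hq | hq
  · rw [Set.Ioc_eq_empty (by linarith)]
    simp [lpP]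
    exact hM.le
  have hd : ∀ t ∈ Set.uIcc (w.re + M * w.im) q,
      HasDerivAt (fun t => -w.im / (t - w.re)) (w.im / (t - w.re) ^ 2) t := by
    intro t ht
    rw [Set.uIcc_of_le hq.le] at ht
    have h0 : t - w.re ≠ 0 := by linarith [ht.1]
    have := (hasDerivAt_const t (-w.im)).div ((hasDerivAt_id t).sub_const w.re) h0
    refine this.congr_deriv ?_
    simp
  have hc : ContinuousOn (fun t => w.im / (t - w.re) ^ 2) (Set.uIcc (w.re + M * w.im) q) := by
    refine continuousOn_const.div (by fun_prop) fun t ht => ?_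
    rw [Set.uIcc_of_le hq.le] at ht
    have h0 : t - w.re ≠ 0 := by linarith [ht.1]
    positivity
  have hi := intervalIntegral.integral_eq_sub_of_hasDerivAt hd hc.intervalIntegrable
  have h1 : lpP (Set.Ioc (w.re + M * w.im) q) w ≤
      ∫ t in (w.re + M * w.im)..q, w.im / (t - w.re) ^ 2 := by
    rw [intervalIntegral.integral_of_le hq.le]
    refine setIntegral_mono_on (lp_intP hw (by simp)) hc.intervalIntegrable.1 measurableSet_Ioc ?_
    intro t ht
    have h0 : t - w.re ≠ 0 := by linarith [ht.1]
    have h2 : (w.re - t) ^ 2 = (t - w.re) ^ 2 := by ring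
    rw [h2]
    gcongr
    nlinarith
  rw [hi] at h1
  refine h1.trans ?_
  have h3 : 0 ≤ w.im / (q - w.re) := div_nonneg hw.le (by linarith)
  have h4 : -w.im / (w.re + M * w.im - w.re) = - (1 / M) := by
    rw [add_sub_cancel_left]; field_simp
  rw [h4, neg_div]
  linarith

lemma lp_far_left {w : ℂ} (hw : 0 < w.im) {M : ℝ} (hM : 0 < M) (q : ℝ) :
    lpP (Set.Ioc q (w.re - M * w.im)) w ≤ 1 / M := by
  have hMw : 0 < M * w.im := by positivity
  rcases le_or_gt (w.re - M * w.im) q with hq | hq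
  · rw [Set.Ioc_eq_empty (by linarith)]
    simp [lpP]
    exact hM.le
  have hd : ∀ t ∈ Set.uIcc q (w.re - M * w.im),
      HasDerivAt (fun t => -w.im / (t - w.re)) (w.im / (t - w.re) ^ 2) t := by
    intro t ht
    rw [Set.uIcc_of_le hq.le] at ht
    have h0 : t - w.re ≠ 0 := by linarith [ht.2]
    have := (hasDerivAt_const t (-w.im)).div ((hasDerivAt_id t).sub_const w.re) h0
    refine this.congr_deriv ?_
    simp
  have hc : ContinuousOn (fun t => w.im / (t - w.re) ^ 2) (Set.uIcc q (w.re - M * w.im)) := by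
    refine continuousOn_const.div (by fun_prop) fun t ht => ?_
    rw [Set.uIcc_of_le hq.le] at ht
    have h0 : t - w.re ≠ 0 := by linarith [ht.2]
    positivity
  have hi := intervalIntegral.integral_eq_sub_of_hasDerivAt hd hc.intervalIntegrable
  have h1 : lpP (Set.Ioc q (w.re - M * w.im)) w ≤
      ∫ t in q..(w.re - M * w.im), w.im / (t - w.re) ^ 2 := by
    rw [intervalIntegral.integral_of_le hq.le]
    refine setIntegral_mono_on (lp_intP hw (by simp)) hc.intervalIntegrable.1 measurableSet_Ioc ?_
    intro t ht
    have h0 : t - w.re ≠ 0 := by linarith [ht.2]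
    have h2 : (w.re - t) ^ 2 = (t - w.re) ^ 2 := by ring
    rw [h2]
    gcongr
    nlinarith
  rw [hi] at h1
  refine h1.trans ?_
  have h3 : -w.im / (q - w.re) ≥ 0 := div_nonneg_of_nonpos (by linarith) (by linarith)
  have h4 : -w.im / (w.re - M * w.im - w.re) = 1 / M := by
    rw [sub_sub_cancel_left]; field_simp
  rw [h4]
  linarith

lemma lp_density (K : Set ℝ) (hKm : MeasurableSet K) (hK : 0 < volume K) (p q : ℝ) :
    ∃ t₀ ∈ K, ∃ y₀ > 0, ∀ w : ℂ, w.re = t₀ → 0 < w.im → w.im < y₀ →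
      lpP (Set.Icc p q \ K) w < 1 / 2 := by
  have hae := Besicovitch.ae_tendsto_measure_inter_div (volume : Measure ℝ) K
  have hne : (volume.restrict K) ≠ 0 := by
    rw [Ne, Measure.restrict_eq_zero]; exact hK.ne'
  obtain ⟨t₀, ht, htK⟩ : ∃ t₀, Tendsto (fun r => volume (K ∩ Metric.closedBall t₀ r) /
      volume (Metric.closedBall t₀ r)) (𝓝[>] 0) (𝓝 1) ∧ t₀ ∈ K := by
    have : NeBot (ae (volume.restrict K)) := ae_neBot.2 hne
    exact (hae.and (ae_restrict_mem hKm)).exists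
  have ht' := (ENNReal.tendsto_toReal ENNReal.one_ne_top).comp ht
  have hev := ht'.eventually (lt_mem_nhds (b := (1 : ENNReal).toReal) (a := 1 - 1 / 256) (by norm_num))
  rw [eventually_nhdsWithin_iff, Metric.eventually_nhds_iff] at hev
  obtain ⟨ε, hε, hev⟩ := hev
  refine ⟨t₀, htK, ε / 16, by positivity, fun w hwr hw hwy => ?_⟩
  have h1 := @hev (16 * w.im) (by rw [Real.dist_eq, abs_lt]; constructor <;> linarith)
    (by simpa using hw)
  simp only [Function.comp, ENNReal.toReal_div] at h1
  set Bl := Metric.closedBall t₀ (16 * w.im) with hBl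
  have hvB : volume.real Bl = 32 * w.im := by
    rw [hBl, measureReal_def, Real.volume_closedBall, ENNReal.toReal_ofReal (by positivity)]; ring
  have hBfin : volume Bl ≠ ⊤ := by rw [hBl, Real.volume_closedBall]; exact ENNReal.ofReal_ne_top
  change _ < volume.real _ / volume.real Bl at h1
  rw [hvB, lt_div_iff₀ (by positivity)] at h1
  have h2 := measureReal_inter_add_sdiff (μ := volume) (s := Bl) hKm hBfin
  rw [Set.inter_comm, hvB] at h2
  have hDfin : volume (Bl \ K) ≠ ⊤ := ((measure_mono Set.sdiff_subset).trans_lt hBfin.lt_top).ne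
  have h3 := lp_P_le hw hDfin
  have h4 : volume.real (Bl \ K) / w.im ≤ 1 / 8 := by
    rw [div_le_iff₀ hw]; linarith
  have hsub : Set.Icc p q \ K ⊆ (Set.Ioc (w.re + 16 * w.im) q ∪ Set.Ioc (p - 1) (w.re - 16 * w.im)) ∪
      (Bl \ K) := by
    rintro t ⟨⟨hp, hq⟩, htK⟩
    by_cases c1 : w.re + 16 * w.im < t
    · exact Or.inl (Or.inl ⟨c1, hq⟩)
    by_cases c2 : t ≤ w.re - 16 * w.im
    · exact Or.inl (Or.inr ⟨by linarith, c2⟩)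
    refine Or.inr ⟨?_, htK⟩
    rw [hBl, Metric.mem_closedBall, Real.dist_eq, abs_le]
    constructor <;> linarith
  have h5 := lp_P_union hw (measure_union_lt_top (by simp) (by simp)).ne hDfin
    (measurableSet_closedBall.diff hKm) hsub
  have h6 := lp_P_union hw (A := Set.Ioc (w.re + 16 * w.im) q ∪ Set.Ioc (p - 1) (w.re - 16 * w.im))
    (A' := Set.Ioc (w.re + 16 * w.im) q) (D := Set.Ioc (p - 1) (w.re - 16 * w.im)) (by simp) (by simp)
    measurableSet_Ioc subset_rfl
  have h7 := lp_far_right hw (M := 16) (by norm_num) q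
  have h8 := lp_far_left hw (M := 16) (by norm_num) (p - 1)
  linarith

lemma lp_B_anti (f : ℂ → ℂ) {h h' ε : ℝ} (hh : h' ≤ h) : lpB f h ε ⊆ lpB f h' ε :=
  fun _ ht w h0 h1 h2 => ht w h0 (h1.trans_le hh) h2

lemma lp_half (f : ℂ → ℂ) (hf : ∀ w : ℂ, 0 < w.im → DifferentiableAt ℂ f w) (E : Set ℝ)
    (hE : 0 < volume E) (hlim : ∀ t ∈ E, ∀ ε > 0, ∃ h > 0, t ∈ lpB f h ε) :
    ∃ t₀ : ℝ, ∃ y₀ > 0, ∀ w : ℂ, w.re = t₀ → 0 < w.im → w.im < y₀ → f w = 0 := by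
  set Es : Set ℝ := ⋂ k : ℕ, ⋃ j : ℕ, lpB f (1 / ((j : ℝ) + 1)) (Real.exp (-(k : ℝ))) with hEs
  have hex : ∀ h > (0 : ℝ), ∃ j : ℕ, 1 / ((j : ℝ) + 1) < h := fun h hh => exists_nat_one_div_lt hh
  set K0 : ℕ → ℕ → Set ℝ := fun n m =>
    Set.Icc (-(n : ℝ)) n ∩ lpB f (2 * (1 / ((m : ℝ) + 1))) 1 ∩ Es with hK0
  have hEsm : MeasurableSet Es :=
    MeasurableSet.iInter fun k => MeasurableSet.iUnion fun j => (lp_B_closed f _ _).measurableSet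
  have hK0m : ∀ n m, MeasurableSet (K0 n m) := fun n m =>
    (measurableSet_Icc.inter (lp_B_closed f _ _).measurableSet).inter hEsm
  have hcover : E ⊆ ⋃ n, ⋃ m, K0 n m := by
    intro t ht
    obtain ⟨n, hn⟩ := exists_nat_ge |t|
    obtain ⟨h, hh, hB⟩ := hlim t ht 1 one_pos
    obtain ⟨m, hm⟩ := hex (h / 2) (by positivity)
    refine Set.mem_iUnion.2 ⟨n, Set.mem_iUnion.2 ⟨m, ⟨abs_le.1 hn, lp_B_anti f (by linarith) hB⟩, ?_⟩⟩
    refine Set.mem_iInter.2 fun k => ?_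
    obtain ⟨h, hh, hB⟩ := hlim t ht _ (Real.exp_pos (-(k : ℝ)))
    obtain ⟨j, hj⟩ := hex h hh
    exact Set.mem_iUnion.2 ⟨j, lp_B_anti f hj.le hB⟩
  obtain ⟨n, m, hpos⟩ : ∃ n m, 0 < volume (K0 n m) := by
    by_contra hno
    push Not at hno
    have : volume (⋃ n, ⋃ m, K0 n m) = 0 :=
      measure_iUnion_null fun n => measure_iUnion_null fun m => le_antisymm (hno n m) zero_le
    exact hE.ne' (measure_mono_null hcover this)
  set h : ℝ := 1 / ((m : ℝ) + 1) with hh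
  have hh0 : 0 < h := by positivity
  have hh1 : h ≤ 1 := by
    rw [hh, div_le_one (by positivity)]; have : (0 : ℝ) ≤ m := Nat.cast_nonneg m
    linarith
  obtain ⟨t₀, ht₀, y₀, hy₀, hd⟩ := lp_density (K0 n m) (hK0m n m) hpos (-(n : ℝ) - 3) (n + 3)
  refine ⟨t₀, min y₀ (h / 4), lt_min hy₀ (by positivity), fun w hwr hw hwy => ?_⟩
  have hw1 := hwy.trans_le (min_le_left _ _)
  have hw2 := hwy.trans_le (min_le_right _ _)
  have hP0 := hd w hwr hw hw1
  have hKfin : volume (K0 n m) ≠ ⊤ := by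
    have : K0 n m ⊆ Set.Icc (-(n : ℝ)) n := fun t ht => ht.1.1
    exact ((measure_mono this).trans_lt (by simp)).ne
  have key : ∀ k : ℕ, ‖f w‖ ≤ Real.exp (-((k : ℝ) * (1 / 8))) := by
    intro k
    set D : ℕ → Set ℝ := fun j => K0 n m \ lpB f (1 / ((j : ℝ) + 1)) (Real.exp (-(k : ℝ))) with hD
    have hDm : ∀ j, MeasurableSet (D j) := fun j =>
      (hK0m n m).diff (lp_B_closed f _ _).measurableSet
    have hDa : Antitone D := by
      intro i j hij
      refine Set.sdiff_subset_sdiff_right (lp_B_anti f ?_)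
      have : (i : ℝ) ≤ j := by exact_mod_cast hij
      gcongr
    have hDe : ⋂ j, D j = ∅ := by
      rw [Set.eq_empty_iff_forall_notMem]
      intro t ht
      rw [Set.mem_iInter] at ht
      obtain ⟨j, hj⟩ := Set.mem_iUnion.1 (Set.mem_iInter.1 (ht 0).1.2 k)
      exact (ht j).2 hj
    have hDf : ∀ j, volume (D j) ≠ ⊤ := fun j =>
      ((measure_mono Set.sdiff_subset).trans_lt hKfin.lt_top).ne
    have hDt := tendsto_measure_iInter_atTop (μ := volume) (fun j => (hDm j).nullMeasurableSet) hDa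
      ⟨0, hDf 0⟩
    rw [hDe, measure_empty] at hDt
    have hDt' := (ENNReal.tendsto_toReal ENNReal.zero_ne_top).comp hDt
    obtain ⟨j, hj⟩ := (hDt'.eventually_lt_const (u := w.im / 8)
      (by rw [ENNReal.toReal_zero]; positivity)).exists
    change volume.real (D j) < w.im / 8 at hj
    have hPD := lp_P_le hw (hDf j)
    have hj' : volume.real (D j) / w.im ≤ 1 / 8 := by rw [div_le_iff₀ hw]; linarith
    set K : Set ℝ := K0 n m ∩ lpB f (1 / ((j : ℝ) + 1)) (Real.exp (-(k : ℝ))) with hK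
    have hsub : Set.Icc (-(n : ℝ) - 3) (n + 3) \ K ⊆ (Set.Icc (-(n : ℝ) - 3) (n + 3) \ K0 n m) ∪ D j := by
      rintro t ⟨h1, h2⟩
      by_cases c : t ∈ K0 n m
      · exact Or.inr ⟨c, fun h3 => h2 ⟨c, h3⟩⟩
      · exact Or.inl ⟨h1, c⟩
    have hu := lp_P_union hw ((measure_mono Set.sdiff_subset).trans_lt (by simp)).ne (hDf j) (hDm j) hsub
    have hmx := lp_max f hf K (-(n : ℝ)) n h k (1 / ((j : ℝ) + 1)) hh0 hh1 (Nat.cast_nonneg k)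
      (by positivity) (fun t ht => ht.1.1.1) (fun t ht => ht.1.1.2) (fun t ht => ht.2) w hw
      (by linarith) (by rw [hwr]; exact ht₀.1.1) (by linarith)
    refine hmx.trans ?_
    have hy : w.im / h ≤ 1 / 4 := by rw [div_le_iff₀ hh0]; linarith
    gcongr
    linarith
  have hlim0 : Tendsto (fun k : ℕ => Real.exp (-((k : ℝ) * (1 / 8)))) atTop (𝓝 0) := by
    refine Real.tendsto_exp_neg_atTop_nhds_zero.comp ?_
    exact tendsto_natCast_atTop_atTop.atTop_mul_const (by norm_num)
  have := ge_of_tendsto' hlim0 key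
  exact norm_le_zero_iff.1 this

lemma lp_cone (F : ℂ → ℂ) (t : ℝ)
    (hlim : ∀ C : ℝ, 1 < C →
      Tendsto F (𝓝[stolzAngle (Complex.exp (t * Complex.I)) C]
        (Complex.exp (t * Complex.I))) (𝓝 0)) (ε : ℝ) (hε : 0 < ε) :
    ∃ h > 0, t ∈ lpB (fun w => F (Complex.exp (Complex.I * w))) h ε := by
  have h1 := (hlim 12 (by norm_num)).eventually (Metric.closedBall_mem_nhds 0 hε)
  rw [eventually_nhdsWithin_iff, Metric.eventually_nhds_iff] at h1
  obtain ⟨δ, hδ, h1⟩ := h1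
  refine ⟨min (1 / 3) (δ / 6), by positivity, fun w hw hwh hwt => ?_⟩
  have hw1 := hwh.trans_le (min_le_left _ _)
  have hw2 := hwh.trans_le (min_le_right _ _)
  have hu : ‖w - (t : ℂ)‖ ≤ 3 * w.im := by
    refine (Complex.norm_le_abs_re_add_abs_im _).trans ?_
    simp
    rw [abs_of_pos hw]; linarith
  have hexp : Complex.exp (Complex.I * w) - Complex.exp (t * Complex.I) =
      Complex.exp (t * Complex.I) * (Complex.exp (Complex.I * (w - t)) - 1) := by
    rw [mul_sub, ← Complex.exp_add, mul_one]
    congr 2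
    ring
  have hd : ‖Complex.exp (Complex.I * w) - Complex.exp (t * Complex.I)‖ ≤ 6 * w.im := by
    rw [hexp, norm_mul, Complex.norm_exp_ofReal_mul_I, one_mul]
    have hn : ‖Complex.I * (w - t)‖ = ‖w - (t : ℂ)‖ := by rw [norm_mul, Complex.norm_I, one_mul]
    have := Complex.norm_exp_sub_one_le (x := Complex.I * (w - t)) (by rw [hn]; linarith)
    rw [hn] at this
    linarith
  have hnz : ‖Complex.exp (Complex.I * w)‖ = Real.exp (-w.im) := by
    rw [Complex.norm_exp]; simp
  have hlow : w.im / 2 ≤ 1 - Real.exp (-w.im) := by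
    have h2 := Real.add_one_le_exp w.im
    have h3 : Real.exp (-w.im) ≤ 1 / (w.im + 1) := by
      rw [Real.exp_neg, ← one_div]; gcongr
    have h4 : 1 / (w.im + 1) ≤ 1 - w.im / 2 := by
      rw [div_le_iff₀ (by linarith)]; nlinarith
    linarith
  have := h1 (y := Complex.exp (Complex.I * w)) (by rw [dist_eq_norm]; linarith)
    ⟨by rw [hnz]; linarith, by rw [hnz]; linarith⟩
  simpa using this

/-- **Lusin–Privalov uniqueness theorem** (as used in the paper): if
`F(z) = ∑_{k>0} c_k z^k` is analytic on the open unit disc and its non-tangential limit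
exists and equals `0` at `e^{it}` for every `t` in a set `E ⊆ ℝ` of positive Lebesgue
measure, then `F` vanishes identically, i.e. all the coefficients `c_k` vanish. -/
theorem lusin_privalov (c : ℕ → ℂ) (F : ℂ → ℂ) (hc0 : c 0 = 0)
    (hF : ∀ z ∈ Metric.ball (0 : ℂ) 1, HasSum (fun k : ℕ => c k * z ^ k) (F z))
    (E : Set ℝ) (hE : 0 < volume E)
    (hlim : ∀ t ∈ E, ∀ C : ℝ, 1 < C →
      Tendsto F (𝓝[stolzAngle (Complex.exp (t * Complex.I)) C]
        (Complex.exp (t * Complex.I))) (𝓝 0)) :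
    ∀ k : ℕ, c k = 0 := by
  have hball : ∀ z : ℂ, z ∈ Metric.ball (0 : ℂ) 1 ↔ ‖z‖ < 1 := by simp
  set p : FormalMultilinearSeries ℂ ℂ ℂ := FormalMultilinearSeries.ofScalars ℂ c with hp
  have hps : HasFPowerSeriesOnBall F p 0 1 := by
    refine ⟨?_, by simp, ?_⟩
    · refine ENNReal.le_of_forall_nnreal_lt fun r hr => ?_
      have hr1 : (r : ℝ) < 1 := by exact_mod_cast hr
      refine p.le_radius_of_tendsto (l := 0) ?_
      have hs := (hF (r : ℝ) (by simpa using hr1)).summable.tendsto_atTop_zero.norm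
      simpa [hp, FormalMultilinearSeries.ofScalars_norm] using hs
    · intro y hy
      have hy' : y ∈ Metric.ball (0 : ℂ) 1 := by
        rwa [← ENNReal.ofReal_one, Metric.eball_ofReal] at hy
      have := hF y hy'
      simpa [hp, FormalMultilinearSeries.ofScalars_apply_eq, smul_eq_mul, mul_comm] using this
  have hana : AnalyticOnNhd ℂ F (Metric.ball 0 1) := by
    have := hps.analyticOnNhd
    rwa [← ENNReal.ofReal_one, Metric.eball_ofReal] at this
  have hnz : ∀ w : ℂ, ‖Complex.exp (Complex.I * w)‖ = Real.exp (-w.im) := by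
    intro w; rw [Complex.norm_exp]; simp
  obtain ⟨t₀, y₀, hy₀, hz⟩ := lp_half (fun w => F (Complex.exp (Complex.I * w))) (by
    intro w hw
    have h1 : DifferentiableAt ℂ F (Complex.exp (Complex.I * w)) := by
      refine (hana _ ?_).differentiableAt
      rw [hball, hnz, Real.exp_lt_one_iff]; linarith
    exact h1.comp w (by fun_prop)) E hE (fun t ht ε hε => lp_cone F t (hlim t ht) ε hε)
  set w₀ : ℂ := ⟨t₀, y₀ / 2⟩ with hw₀
  have hz₀ : Complex.exp (Complex.I * w₀) ∈ Metric.ball (0 : ℂ) 1 := by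
    rw [hball, hnz, Real.exp_lt_one_iff]
    simp [hw₀]; exact hy₀
  have hfreq : ∃ᶠ z in 𝓝[≠] (Complex.exp (Complex.I * w₀)), F z = 0 := by
    set γ : ℝ → ℂ := fun y => Complex.exp (Complex.I * ⟨t₀, y⟩) with hγ
    have hγc : Continuous γ := by
      have : γ = fun y : ℝ => Complex.exp (Complex.I * (t₀ + y * Complex.I)) := by
        ext y; simp only [hγ]; rw [Complex.mk_eq_add_mul_I]
      rw [this]; fun_prop
    have htend : Tendsto γ (𝓝[≠] (y₀ / 2)) (𝓝[≠] (Complex.exp (Complex.I * w₀))) := by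
      refine tendsto_nhdsWithin_iff.2 ⟨(hγc.tendsto (y₀ / 2)).mono_left nhdsWithin_le_nhds, ?_⟩
      filter_upwards [self_mem_nhdsWithin] with y hy heq
      apply hy
      have := congrArg norm heq
      simp only [hγ] at this
      rw [hnz, hnz, Real.exp_eq_exp] at this
      simpa [hw₀] using this
    refine htend.frequently (Eventually.frequently ?_)
    have : ∀ᶠ y in 𝓝 (y₀ / 2), y ∈ Set.Ioo 0 y₀ := Ioo_mem_nhds (by linarith) (by linarith)
    filter_upwards [nhdsWithin_le_nhds this] with y hy
    exact hz ⟨t₀, y⟩ rfl hy.1 hy.2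
  have hzero := hana.eqOn_zero_of_preconnected_of_frequently_eq_zero
    (convex_ball (0 : ℂ) 1).isPreconnected hz₀ hfreq
  have hev : F =ᶠ[𝓝 0] 0 := by
    filter_upwards [Metric.ball_mem_nhds (0 : ℂ) one_pos] with z hz using hzero hz
  have hp0 : p = 0 := (hps.hasFPowerSeriesAt.congr hev).eq_zero
  intro k
  have : ‖p k‖ = 0 := by rw [hp0]; simp
  rw [hp, FormalMultilinearSeries.ofScalars_norm] at this
  exact norm_eq_zero.1 this
end
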